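/- Let f_θ : ℝ^D → ℝ^O be a fully-connected network of depth L in the ReLU-MLP setting (ReLU activations, all hidden widths equal to n, He/fan-in initialization W^(l)_{ij} ~ N(0, 1/n_{l-1}) i.i.d.), and fix inputs x₁, x₂ lying in a compact set. Let Θ_θ(x₁,x₂) ∈ ℝ^{O×O} be the empirical NTK and Θ̂_θ(x₁,x₂) ∈ ℝ the pseudo-NTK. Then for every δ > 0 there exist n₀ ∈ ℕ and a constant C (independent of n) such that for all n > n₀, with probability at least 1 − δ over the random initialization, ‖Θ_θ(x₁,x₂) − Θ̂_θ(x₁,x₂)·I_O‖_F / ‖Θ_θ(x₁,x₂)‖_F ≤ C·n^{−1/2}. -/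

import Mathlib

open MeasureTheory ProbabilityTheory

noncomputable section

/-- The ReLU activation. -/
def relu (t : ℝ) : ℝ := max t 0

/-- Parameter space of an `L`-layer fully-connected network with widths `w`:
`w 0` is the input dimension and `w L` the output dimension. -/
abbrev Params (L : ℕ) (w : ℕ → ℕ) : Type :=
  (l : Fin L) → Fin (w (l.val + 1)) → Fin (w l.val) → ℝ

/-- Extend a finite family of weight matrices to all layer indices (zero beyond `L`). -/
def extParams {L : ℕ} {w : ℕ → ℕ} (θ : Params L w) (l : ℕ) :
    Fin (w (l + 1)) → Fin (w l) → ℝ :=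
  if h : l < L then θ ⟨l, h⟩ else 0

/-- Post-activations of layer `l` (ReLU applied coordinatewise); `layerOut w θ 0 x = x`. -/
def layerOut (w : ℕ → ℕ) (θ : (l : ℕ) → Fin (w (l + 1)) → Fin (w l) → ℝ) :
    (l : ℕ) → (Fin (w 0) → ℝ) → Fin (w l) → ℝ
  | 0, x => x
  | l + 1, x => fun i => relu (∑ j, θ l i j * layerOut w θ l x j)

/-- Network output: a linear read-out layer on top of `L - 1` ReLU layers. -/
def netOut (w : ℕ → ℕ) (θ : (l : ℕ) → Fin (w (l + 1)) → Fin (w l) → ℝ) :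
    (L : ℕ) → (Fin (w 0) → ℝ) → Fin (w L) → ℝ
  | 0, x => x
  | L + 1, x => fun i => ∑ j, θ L i j * layerOut w θ L x j

/-- The fully-connected network, as a function of its parameters. -/
def fnet (L : ℕ) (w : ℕ → ℕ) (θ : Params L w) (x : Fin (w 0) → ℝ) : Fin (w L) → ℝ :=
  netOut w (extParams θ) L x

/-- Partial derivative of a scalar function of the parameters with respect to the
weight with coordinates `(l, i, j)` (defined via the Fréchet derivative, which exists
almost surely for the networks considered here). -/
def pderiv {L : ℕ} {w : ℕ → ℕ} (F : Params L w → ℝ) (θ : Params L w)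
    (l : Fin L) (i : Fin (w (l.val + 1))) (j : Fin (w l.val)) : ℝ :=
  fderiv ℝ F θ (Pi.single l (Pi.single i (Pi.single j (1 : ℝ))))

/-- The empirical NTK `Θ_θ(x₁, x₂) = J_θ(f_θ(x₁)) J_θ(f_θ(x₂))ᵀ ∈ ℝ^{O×O}`. -/
def eNTK (L : ℕ) (w : ℕ → ℕ) (θ : Params L w) (x₁ x₂ : Fin (w 0) → ℝ) :
    Matrix (Fin (w L)) (Fin (w L)) ℝ := fun i₁ i₂ =>
  ∑ l : Fin L, ∑ a : Fin (w (l.val + 1)), ∑ b : Fin (w l.val),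
    pderiv (fun θ' => fnet L w θ' x₁ i₁) θ l a b *
      pderiv (fun θ' => fnet L w θ' x₂ i₂) θ l a b

/-- The pseudo-NTK ("sum of logits"): the scalar kernel
`⟨∇_θ (1/√O) ∑ᵢ f^{(i)}_θ(x₁), ∇_θ (1/√O) ∑ᵢ f^{(i)}_θ(x₂)⟩`. -/
def pNTK (L : ℕ) (w : ℕ → ℕ) (θ : Params L w) (x₁ x₂ : Fin (w 0) → ℝ) : ℝ :=
  ∑ l : Fin L, ∑ a : Fin (w (l.val + 1)), ∑ b : Fin (w l.val),
    pderiv (fun θ' => (Real.sqrt (w L))⁻¹ * ∑ i, fnet L w θ' x₁ i) θ l a b *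
      pderiv (fun θ' => (Real.sqrt (w L))⁻¹ * ∑ i, fnet L w θ' x₂ i) θ l a b

/-- He ("fan-in") initialization: all weights independent, `W^{(l)}_{ij} ~ N(0, 1/n_{l-1})`. -/
def initMeasure (L : ℕ) (w : ℕ → ℕ) : Measure (Params L w) :=
  Measure.pi fun l => Measure.pi fun _ => Measure.pi fun _ =>
    gaussianReal 0 ((w l.val : NNReal))⁻¹

/-- Widths of the ReLU-MLP: input dimension `D`, hidden layers of width `n`, output `O`. -/
def widths (D n O L : ℕ) : ℕ → ℕ
  | 0 => D
  | l + 1 => if l + 1 < L then n else O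

/-- Frobenius norm of a real matrix. -/
def frobNorm {m k : Type*} [Fintype m] [Fintype k] (M : Matrix m k ℝ) : ℝ :=
  Real.sqrt (∑ i, ∑ j, (M i j) ^ 2)

section Resampling

variable {ι : Type*} [Fintype ι] [DecidableEq ι] {α : ι → Type*} [∀ i, MeasurableSpace (α i)]
  (μ : ∀ i, Measure (α i)) [∀ i, IsProbabilityMeasure (μ i)]

/-- Resampling one coordinate of a product probability measure preserves it. -/
lemma measurePreserving_pi_update (k : ι) :
    MeasurePreserving (fun p : (∀ i, α i) × α k => Function.update p.1 k p.2)
      ((Measure.pi μ).prod (μ k)) (Measure.pi μ) := by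
  have hm : Measurable (fun p : (∀ i, α i) × α k => Function.update p.1 k p.2) :=
    measurable_update'
  refine ⟨hm, (Measure.pi_eq fun s hs => ?_).symm⟩
  rw [Measure.map_apply hm (MeasurableSet.univ_pi hs)]
  have : (fun p : (∀ i, α i) × α k => Function.update p.1 k p.2) ⁻¹' (Set.univ.pi s) =
      (Set.univ.pi (Function.update s k Set.univ)) ×ˢ (s k) := by
    ext ⟨x, t⟩
    simp only [Set.mem_preimage, Set.mem_pi, Set.mem_univ, true_implies, Set.mem_prod]
    constructor
    · intro h
      refine ⟨fun i => ?_, by simpa using h k⟩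
      by_cases hi : i = k
      · subst hi; simp
      · simpa [hi] using h i
    · rintro ⟨h, hk⟩ i
      by_cases hi : i = k
      · subst hi; simpa using hk
      · simpa [hi] using h i
  rw [this, Measure.prod_prod, Measure.pi_pi,
    ← Finset.prod_erase_mul _ (fun i => μ i (Function.update s k Set.univ i)) (Finset.mem_univ k),
    ← Finset.prod_erase_mul _ (fun i => μ i (s i)) (Finset.mem_univ k)]
  simp only [Function.update_self, measure_univ, mul_one]
  congr 1
  refine Finset.prod_congr rfl fun i hi => ?_
  rw [Function.update_of_ne (Finset.ne_of_mem_erase hi)]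

lemma lintegral_pi_update (k : ι) {f : (∀ i, α i) → ENNReal} (hf : Measurable f) :
    ∫⁻ x, f x ∂(Measure.pi μ) =
      ∫⁻ x, ∫⁻ t, f (Function.update x k t) ∂(μ k) ∂(Measure.pi μ) := by
  have h := measurePreserving_pi_update μ k
  rw [← h.lintegral_comp hf]
  exact lintegral_prod _ (hf.comp h.measurable).aemeasurable

lemma integral_pi_update (k : ι) {f : (∀ i, α i) → ℝ} (hf : Integrable f (Measure.pi μ)) :
    ∫ x, f x ∂(Measure.pi μ) =
      ∫ x, ∫ t, f (Function.update x k t) ∂(μ k) ∂(Measure.pi μ) := by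
  have h := measurePreserving_pi_update μ k
  have h2 := h.integrable_comp_of_integrable hf
  refine Eq.trans ?_ (integral_prod _ h2)
  conv_lhs => rw [← h.map_eq]
  refine integral_map h.measurable.aemeasurable ?_
  rw [h.map_eq]; exact hf.1

end Resampling

section GaussianVectors

variable {ι : Type*} [Fintype ι]

/-- The law of a vector with independent centred Gaussian coordinates of variance `v`. -/
abbrev gaussVec (ι : Type*) [Fintype ι] (v : NNReal) : Measure (ι → ℝ) :=
  Measure.pi fun _ => gaussianReal 0 v

lemma memLp_gaussVec_eval (v : NNReal) (i : ι) (p : ENNReal) (hp : p ≠ ⊤) :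
    MemLp (fun w : ι → ℝ => w i) p (gaussVec ι v) :=
  (memLp_id_gaussianReal' p hp).comp_measurePreserving
    (measurePreserving_eval (fun _ => gaussianReal 0 v) i)

lemma hasGaussianLaw_gaussVec (v : NNReal) :
    HasGaussianLaw (fun (w : ι → ℝ) i => w i) (gaussVec ι v) := by
  refine iIndepFun.hasGaussianLaw (X := fun i (w : ι → ℝ) => w i) (fun i => ?_)
    (iIndepFun_pi (X := fun _ => id) (fun _ => aemeasurable_id))
  refine ⟨?_⟩
  have := (measurePreserving_eval (fun _ : ι => gaussianReal 0 v) i).map_eq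
  change IsGaussian (Measure.map (Function.eval i) (gaussVec ι v))
  rw [this]; infer_instance

/-- The fourth moment of the standard Gaussian. -/
def gaussFourth : ℝ := ∫ t, t ^ 4 ∂(gaussianReal 0 1)

lemma gaussFourth_nonneg : 0 ≤ gaussFourth := integral_nonneg fun t => by positivity

lemma integral_pow_four_gaussianReal (v : NNReal) :
    ∫ t, t ^ 4 ∂(gaussianReal 0 v) = gaussFourth * (v : ℝ) ^ 2 := by
  have h := gaussianReal_map_const_mul (μ := 0) (v := 1) (Real.sqrt v)
  have hv : (NNReal.mk (Real.sqrt v ^ 2) (sq_nonneg _) * 1 : NNReal) = v := by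
    ext; simp
  rw [hv, mul_zero] at h
  rw [← h, integral_map (by fun_prop) (by fun_prop)]
  simp_rw [mul_pow]
  rw [integral_const_mul, gaussFourth, mul_comm]
  congr 1
  rw [show (4 : ℕ) = 2 * 2 from rfl, pow_mul, Real.sq_sqrt v.coe_nonneg]

lemma integrable_pow_gaussianReal (v : NNReal) (k : ℕ) :
    Integrable (fun t => t ^ k) (gaussianReal 0 v) := by
  have := (memLp_id_gaussianReal' (μ := 0) (v := v) k (by simp)).integrable_norm_pow'
  refine (integrable_norm_iff (by fun_prop)).1 ?_
  simpa using this

lemma integral_sq_gaussianReal (v : NNReal) : ∫ t, t ^ 2 ∂(gaussianReal 0 v) = v := by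
  have := variance_fun_id_gaussianReal (μ := 0) (v := v)
  rwa [variance_of_integral_eq_zero (by fun_prop) (by simp)] at this

lemma integrable_gaussVec_pow (v : NNReal) (c : ι) (k : ℕ) :
    Integrable (fun w : ι → ℝ => w c ^ k) (gaussVec ι v) :=
  (measurePreserving_eval (fun _ : ι => gaussianReal 0 v) c).integrable_comp_of_integrable
    (integrable_pow_gaussianReal v k)

lemma integral_gaussVec_eval (v : NNReal) (c : ι) {f : ℝ → ℝ} (hf : Measurable f) :
    ∫ w : ι → ℝ, f (w c) ∂(gaussVec ι v) = ∫ t, f t ∂(gaussianReal 0 v) := by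
  have h := measurePreserving_eval (fun _ : ι => gaussianReal 0 v) c
  rw [← h.map_eq, integral_map h.measurable.aemeasurable hf.aestronglyMeasurable]

/-- Centred products of coordinates. -/
def centredProd [DecidableEq ι] (v : NNReal) (c d : ι) (w : ι → ℝ) : ℝ :=
  w c * w d - if c = d then (v : ℝ) else 0

variable [DecidableEq ι]

lemma centredProd_comm (v : NNReal) (c d : ι) : centredProd v c d = centredProd v d c := by
  ext w
  simp only [centredProd, mul_comm (w c), eq_comm]

lemma memLp_centredProd (v : NNReal) (c d : ι) :
    MemLp (centredProd v c d) 2 (gaussVec ι v) := by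
  have : ENNReal.HolderTriple 4 4 2 := ⟨by
    rw [← two_mul, show (4 : ENNReal) = 2 * 2 by norm_num,
      ENNReal.mul_inv (by simp) (by simp), ← mul_assoc, ENNReal.mul_inv_cancel (by simp) (by simp),
      one_mul]⟩
  exact ((memLp_gaussVec_eval v d 4 (by simp)).mul (memLp_gaussVec_eval v c 4 (by simp))).sub
    (memLp_const _)

lemma integrable_centredProd_mul (v : NNReal) (c d c' d' : ι) :
    Integrable (fun w => centredProd v c d w * centredProd v c' d' w) (gaussVec ι v) :=
  (memLp_centredProd v c d).integrable_mul (memLp_centredProd v c' d')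

lemma integral_centredProd_update (v : NNReal) (k d : ι) (w : ι → ℝ) :
    ∫ t, centredProd v k d (Function.update w k t) ∂(gaussianReal 0 v) = 0 := by
  by_cases h : k = d
  · subst h
    simp only [centredProd, Function.update_self, if_true, ← pow_two]
    rw [integral_sub (integrable_pow_gaussianReal v 2) (integrable_const _)]
    simp [integral_sq_gaussianReal]
  · simp only [centredProd, Function.update_self, if_neg h, Function.update_of_ne (Ne.symm h),
      sub_zero, integral_mul_const]
    simp

lemma integral_centredProd (v : NNReal) (c d : ι) :
    ∫ w, centredProd v c d w ∂(gaussVec ι v) = 0 := by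
  rw [integral_pi_update _ c ((memLp_centredProd v c d).integrable (by norm_num))]
  simp [integral_centredProd_update]

lemma integral_centredProd_mul_of_notMem (v : NNReal) (k d c' d' : ι) (h1 : k ≠ c')
    (h2 : k ≠ d') :
    ∫ w, centredProd v k d w * centredProd v c' d' w ∂(gaussVec ι v) = 0 := by
  rw [integral_pi_update _ k (integrable_centredProd_mul v k d c' d')]
  have : ∀ (w : ι → ℝ) t, centredProd v c' d' (Function.update w k t) = centredProd v c' d' w := by
    intro w t
    simp [centredProd, Function.update_of_ne h1.symm, Function.update_of_ne h2.symm]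
  simp only [this, integral_mul_const, integral_centredProd_update, zero_mul, integral_zero]

lemma integral_centredProd_mul (v : NNReal) (c d c' d' : ι)
    (h : ¬ ((c' = c ∧ d' = d) ∨ (c' = d ∧ d' = c))) :
    ∫ w, centredProd v c d w * centredProd v c' d' w ∂(gaussVec ι v) = 0 := by
  by_cases h1 : c ≠ c' ∧ c ≠ d'
  · exact integral_centredProd_mul_of_notMem v c d c' d' h1.1 h1.2
  by_cases h2 : d ≠ c' ∧ d ≠ d'
  · rw [centredProd_comm v c d]
    exact integral_centredProd_mul_of_notMem v d c c' d' h2.1 h2.2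
  simp_rw [mul_comm (centredProd v c d _)]
  by_cases h3 : c' ≠ c ∧ c' ≠ d
  · exact integral_centredProd_mul_of_notMem v c' d' c d h3.1 h3.2
  by_cases h4 : d' ≠ c ∧ d' ≠ d
  · rw [centredProd_comm v c' d']
    exact integral_centredProd_mul_of_notMem v d' c' c d h4.1 h4.2
  exfalso; grind

/-- A bound for second moments of centred products of standard Gaussians. -/
def prodConst : ℝ := 2 * gaussFourth + 2

lemma prodConst_nonneg : 0 ≤ prodConst := by
  have := gaussFourth_nonneg; unfold prodConst; positivity

lemma integral_centredProd_sq_le (v : NNReal) (c d : ι) :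
    ∫ w, centredProd v c d w ^ 2 ∂(gaussVec ι v) ≤ prodConst * (v : ℝ) ^ 2 := by
  have h4 : ∀ c : ι, ∫ w : ι → ℝ, w c ^ 4 ∂(gaussVec ι v) = gaussFourth * (v : ℝ) ^ 2 := by
    intro c
    rw [integral_gaussVec_eval v c (f := fun t => t ^ 4) (by fun_prop),
      integral_pow_four_gaussianReal]
  have hi := fun c : ι => integrable_gaussVec_pow v c 4
  calc ∫ w, centredProd v c d w ^ 2 ∂(gaussVec ι v)
      ≤ ∫ w, ((w c ^ 4 + w d ^ 4) + 2 * (v : ℝ) ^ 2) ∂(gaussVec ι v) := by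
        refine integral_mono (memLp_centredProd v c d).integrable_sq
          (((hi c).add (hi d)).add (integrable_const _)) fun w => ?_
        simp only [centredProd]
        split_ifs
        · nlinarith [sq_nonneg (w c ^ 2 - w d ^ 2), sq_nonneg (w c * w d + v)]
        · nlinarith [sq_nonneg (w c ^ 2 - w d ^ 2), sq_nonneg (w c * w d), sq_nonneg (v : ℝ)]
    _ = prodConst * (v : ℝ) ^ 2 := by
        rw [integral_add (f := fun w : ι → ℝ => w c ^ 4 + w d ^ 4) ((hi c).add (hi d))
          (integrable_const _), integral_add (hi c) (hi d),
          h4, h4]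
        simp [prodConst]; ring

lemma abs_integral_centredProd_mul_le (v : NNReal) (c d c' d' : ι) :
    |∫ w, centredProd v c d w * centredProd v c' d' w ∂(gaussVec ι v)| ≤
      prodConst * (v : ℝ) ^ 2 := by
  calc _ ≤ ∫ w, |centredProd v c d w * centredProd v c' d' w| ∂(gaussVec ι v) :=
        abs_integral_le_integral_abs
    _ ≤ ∫ w, (centredProd v c d w ^ 2 * (1 / 2) + centredProd v c' d' w ^ 2 * (1 / 2))
          ∂(gaussVec ι v) := by
        refine integral_mono (integrable_centredProd_mul v c d c' d').abs
          (((memLp_centredProd v c d).integrable_sq.mul_const _).add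
            ((memLp_centredProd v c' d').integrable_sq.mul_const _)) fun w => ?_
        simp only [abs_mul]
        nlinarith [sq_nonneg (|centredProd v c d w| - |centredProd v c' d' w|),
          sq_abs (centredProd v c d w), sq_abs (centredProd v c' d' w)]
    _ ≤ _ := by
        rw [integral_add ((memLp_centredProd v c d).integrable_sq.mul_const _)
          ((memLp_centredProd v c' d').integrable_sq.mul_const _), integral_mul_const,
          integral_mul_const]
        linarith [integral_centredProd_sq_le v c d, integral_centredProd_sq_le v c' d']

lemma memLp_quadForm (v : NNReal) (A : ι → ι → ℝ) :
    MemLp (fun w => ∑ c, ∑ d, A c d * centredProd v c d w) 2 (gaussVec ι v) :=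
  memLp_finsetSum _ fun c _ => memLp_finsetSum _ fun d _ => (memLp_centredProd v c d).const_mul _

lemma integral_quadForm_sq_le (v : NNReal) (A : ι → ι → ℝ) :
    ∫ w, (∑ c, ∑ d, A c d * centredProd v c d w) ^ 2 ∂(gaussVec ι v) ≤
      2 * prodConst * (v : ℝ) ^ 2 * ∑ c, ∑ d, A c d ^ 2 := by
  set B := prodConst * (v : ℝ) ^ 2 with hB
  have hB0 : 0 ≤ B := mul_nonneg prodConst_nonneg (sq_nonneg _)
  have hexp : ∀ w, (∑ c, ∑ d, A c d * centredProd v c d w) ^ 2 =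
      ∑ p : ι × ι, ∑ q : ι × ι, (A p.1 p.2 * A q.1 q.2) *
        (centredProd v p.1 p.2 w * centredProd v q.1 q.2 w) := by
    intro w
    rw [← Fintype.sum_prod_type' (f := fun c d => A c d * centredProd v c d w), pow_two,
      Finset.sum_mul_sum]
    refine Finset.sum_congr rfl fun p _ => Finset.sum_congr rfl fun q _ => by ring
  simp_rw [hexp]
  rw [integral_finsetSum _ fun p _ => integrable_finsetSum _ fun q _ =>
    (integrable_centredProd_mul v _ _ _ _).const_mul _]
  have hterm : ∀ p : ι × ι, ∫ w, ∑ q : ι × ι, (A p.1 p.2 * A q.1 q.2) *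
        (centredProd v p.1 p.2 w * centredProd v q.1 q.2 w) ∂(gaussVec ι v) ≤
      B * (A p.1 p.2 ^ 2 + |A p.1 p.2| * |A p.2 p.1|) := by
    intro p
    rw [integral_finsetSum _ fun q _ => (integrable_centredProd_mul v _ _ _ _).const_mul _]
    have hq : ∀ q : ι × ι, ∫ w, (A p.1 p.2 * A q.1 q.2) *
        (centredProd v p.1 p.2 w * centredProd v q.1 q.2 w) ∂(gaussVec ι v) ≤
        (if q = p then B * A p.1 p.2 ^ 2 else 0) +
          (if q = p.swap then B * (|A p.1 p.2| * |A p.2 p.1|) else 0) := by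
      intro q
      rw [integral_const_mul]
      have hle := abs_integral_centredProd_mul_le v p.1 p.2 q.1 q.2
      by_cases h1 : q = p
      · subst h1
        have : 0 ≤ (if q = q.swap then B * (|A q.1 q.2| * |A q.2 q.1|) else 0) := by
          split_ifs <;> positivity
        rw [if_pos rfl]
        have := le_of_abs_le hle
        nlinarith [mul_le_mul_of_nonneg_left this (mul_self_nonneg (A q.1 q.2))]
      by_cases h2 : q = p.swap
      · subst h2
        rw [if_neg h1, if_pos rfl, zero_add]
        refine (le_abs_self _).trans ?_
        rw [abs_mul, abs_mul]
        exact (mul_le_mul_of_nonneg_left hle (by positivity)).trans (le_of_eq (by simp; ring))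
      · rw [integral_centredProd_mul v p.1 p.2 q.1 q.2, if_neg h1, if_neg h2]
        · simp
        · rintro (⟨h, h'⟩ | ⟨h, h'⟩)
          · exact h1 (Prod.ext h h')
          · exact h2 (Prod.ext h h')
    refine (Finset.sum_le_sum fun q _ => hq q).trans ?_
    rw [Finset.sum_add_distrib]
    simp; ring_nf; rfl
  refine (Finset.sum_le_sum fun p _ => hterm p).trans ?_
  rw [← Finset.mul_sum, Finset.sum_add_distrib]
  have hswap : ∑ p : ι × ι, |A p.1 p.2| * |A p.2 p.1| ≤ ∑ p : ι × ι, A p.1 p.2 ^ 2 := by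
    have h1 : ∑ p : ι × ι, A p.2 p.1 ^ 2 = ∑ p : ι × ι, A p.1 p.2 ^ 2 :=
      (Equiv.prodComm ι ι).sum_comp (fun p : ι × ι => A p.1 p.2 ^ 2)
    have h2 : ∑ p : ι × ι, |A p.1 p.2| * |A p.2 p.1| ≤
        ∑ p : ι × ι, (A p.1 p.2 ^ 2 * (1 / 2) + A p.2 p.1 ^ 2 * (1 / 2)) :=
      Finset.sum_le_sum fun p _ => by
        nlinarith [sq_nonneg (|A p.1 p.2| - |A p.2 p.1|), sq_abs (A p.1 p.2), sq_abs (A p.2 p.1)]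
    rw [Finset.sum_add_distrib, ← Finset.sum_mul, ← Finset.sum_mul, h1] at h2
    linarith
  rw [← Fintype.sum_prod_type' (f := fun c d => A c d ^ 2)]
  nlinarith [mul_le_mul_of_nonneg_left hswap hB0]

lemma sum_centredProd (v : NNReal) (A : ι → ι → ℝ) (w : ι → ℝ) :
    ∑ c, ∑ d, A c d * centredProd v c d w =
      (∑ c, ∑ d, w c * A c d * w d) - v * ∑ c, A c c := by
  simp only [centredProd, mul_sub, Finset.sum_sub_distrib]
  congr 1
  · refine Finset.sum_congr rfl fun c _ => Finset.sum_congr rfl fun d _ => by ring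
  · simp [Finset.mul_sum, mul_comm]

end GaussianVectors

section MeanBounds

variable {Ω : Type*} [MeasurableSpace Ω] {μ : Measure Ω}

/-- `X` is measurable and its positive part has mean at most `C`. -/
def MeanLE (μ : Measure Ω) (X : Ω → ℝ) (C : ℝ) : Prop :=
  Measurable X ∧ 0 ≤ C ∧ ∫⁻ ω, ENNReal.ofReal (X ω) ∂μ ≤ ENNReal.ofReal C

lemma MeanLE.mono {X Y : Ω → ℝ} {C C' : ℝ} (h : MeanLE μ Y C) (hX : Measurable X)
    (hXY : ∀ ω, X ω ≤ Y ω) (hC : C ≤ C') : MeanLE μ X C' :=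
  ⟨hX, h.2.1.trans hC, (lintegral_mono fun ω => ENNReal.ofReal_le_ofReal (hXY ω)).trans
    (h.2.2.trans (ENNReal.ofReal_le_ofReal hC))⟩

lemma MeanLE.add {X Y : Ω → ℝ} {C C' : ℝ} (hX : MeanLE μ X C) (hY : MeanLE μ Y C') :
    MeanLE μ (fun ω => X ω + Y ω) (C + C') := by
  refine ⟨hX.1.add hY.1, add_nonneg hX.2.1 hY.2.1, ?_⟩
  calc _ ≤ ∫⁻ ω, (ENNReal.ofReal (X ω) + ENNReal.ofReal (Y ω)) ∂μ :=
        lintegral_mono fun ω => ENNReal.ofReal_add_le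
    _ = _ := lintegral_add_left hX.1.ennreal_ofReal _
    _ ≤ _ := by
        rw [ENNReal.ofReal_add hX.2.1 hY.2.1]; exact add_le_add hX.2.2 hY.2.2

lemma MeanLE.const_mul {X : Ω → ℝ} {C c : ℝ} (hX : MeanLE μ X C) (hc : 0 ≤ c) :
    MeanLE μ (fun ω => c * X ω) (c * C) := by
  refine ⟨hX.1.const_mul c, mul_nonneg hc hX.2.1, ?_⟩
  simp_rw [ENNReal.ofReal_mul hc]
  rw [lintegral_const_mul _ hX.1.ennreal_ofReal]
  gcongr
  exact hX.2.2

lemma MeanLE.const [IsProbabilityMeasure μ] {C : ℝ} (hC : 0 ≤ C) :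
    MeanLE μ (fun _ => C) C :=
  ⟨measurable_const, hC, by simp⟩

lemma MeanLE.sum {ι : Type*} (s : Finset ι) {X : ι → Ω → ℝ} {C : ι → ℝ}
    (h : ∀ i ∈ s, MeanLE μ (X i) (C i)) :
    MeanLE μ (fun ω => ∑ i ∈ s, X i ω) (∑ i ∈ s, C i) := by
  classical
  induction s using Finset.induction_on with
  | empty => exact ⟨by simp, by simp, by simp⟩
  | insert a s ha ih =>
    simp only [Finset.sum_insert ha]
    exact (h a (by simp)).add (ih fun i hi => h i (by simp [hi]))

lemma MeanLE.sum_univ {ι : Type*} [Fintype ι] {X : ι → Ω → ℝ} {C : ℝ}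
    (h : ∀ i, MeanLE μ (X i) C) :
    MeanLE μ (fun ω => ∑ i, X i ω) (Fintype.card ι * C) := by
  have := MeanLE.sum Finset.univ (fun i _ => h i)
  simpa using this

/-- Markov's inequality. -/
lemma MeanLE.measure_le {X : Ω → ℝ} {C t : ℝ} (h : MeanLE μ X C) (ht : 0 < t) :
    μ {ω | t ≤ X ω} ≤ ENNReal.ofReal (C / t) := by
  have h1 := mul_meas_ge_le_lintegral (μ := μ) h.1.ennreal_ofReal (ENNReal.ofReal t)
  have h2 : {ω | t ≤ X ω} ⊆ {ω | ENNReal.ofReal t ≤ ENNReal.ofReal (X ω)} :=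
    fun ω hω => ENNReal.ofReal_le_ofReal hω
  rw [ENNReal.ofReal_div_of_pos ht, ENNReal.le_div_iff_mul_le (by simp [ht]) (by simp), mul_comm]
  exact (mul_le_mul_right (measure_mono h2) _).trans (h1.trans h.2.2)

lemma meanLE_of_integral_le {X : Ω → ℝ} {C : ℝ} (hm : Measurable X) (h0 : ∀ ω, 0 ≤ X ω)
    (hi : Integrable X μ) (hC : ∫ ω, X ω ∂μ ≤ C) : MeanLE μ X C := by
  refine ⟨hm, (integral_nonneg h0).trans hC, ?_⟩
  rw [← ofReal_integral_eq_lintegral_ofReal hi (ae_of_all _ h0)]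
  exact ENNReal.ofReal_le_ofReal hC

lemma MeanLE.comp_measurePreserving {Ω' : Type*} [MeasurableSpace Ω'] {ν : Measure Ω'}
    {g : Ω' → Ω} {X : Ω → ℝ} {C : ℝ} (h : MeanLE μ X C) (hg : MeasurePreserving g ν μ) :
    MeanLE ν (fun ω => X (g ω)) C :=
  ⟨h.1.comp hg.measurable, h.2.1, by
    rw [hg.lintegral_comp (f := fun ω => ENNReal.ofReal (X ω)) h.1.ennreal_ofReal]; exact h.2.2⟩

/-- Conditioning on all the coordinates but one. -/
lemma MeanLE.of_update {ι : Type*} [Fintype ι] [DecidableEq ι] {α : ι → Type*}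
    [∀ i, MeasurableSpace (α i)] (ν : ∀ i, Measure (α i)) [∀ i, IsProbabilityMeasure (ν i)]
    (k : ι) {X Y : (∀ i, α i) → ℝ} {C : ℝ} (hX : Measurable X) (hY : MeanLE (Measure.pi ν) Y C)
    (h : ∀ x, MeanLE (ν k) (fun t => X (Function.update x k t)) (Y x)) :
    MeanLE (Measure.pi ν) X C := by
  refine ⟨hX, hY.2.1, ?_⟩
  rw [lintegral_pi_update ν k hX.ennreal_ofReal]
  exact (lintegral_mono fun x => (h x).2.2).trans hY.2.2

end MeanBounds

section GaussianForms

variable {ι : Type*} [Fintype ι] {κ : Type*} [Fintype κ]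

lemma relu_nonneg (t : ℝ) : 0 ≤ relu t := le_max_right _ _

lemma relu_sq_le (t : ℝ) : relu t ^ 2 ≤ t ^ 2 := by
  unfold relu
  rcases le_total t 0 with h | h
  · rw [max_eq_right h]; nlinarith [sq_nonneg t]
  · rw [max_eq_left h]

lemma continuous_relu : Continuous relu := by unfold relu; fun_prop

lemma measurable_relu : Measurable relu := continuous_relu.measurable

/-- The law of a matrix with independent centred Gaussian entries of variance `v`. -/
abbrev gaussMat (ι κ : Type*) [Fintype ι] [Fintype κ] (v : NNReal) : Measure (ι → κ → ℝ) :=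
  Measure.pi fun _ => gaussVec κ v

lemma memLp_linForm (v : NNReal) (u : κ → ℝ) (p : ENNReal) (hp : p ≠ ⊤) :
    MemLp (fun w : κ → ℝ => ∑ j, w j * u j) p (gaussVec κ v) :=
  memLp_finsetSum _ fun j _ => (memLp_gaussVec_eval v j p hp).mul_const _

lemma integral_linForm (v : NNReal) (u : κ → ℝ) :
    ∫ w : κ → ℝ, ∑ j, w j * u j ∂(gaussVec κ v) = 0 := by
  rw [integral_finsetSum _ fun j _ =>
    ((memLp_gaussVec_eval v j 1 (by simp)).integrable le_rfl).mul_const _]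
  refine Finset.sum_eq_zero fun j _ => ?_
  rw [integral_mul_const, integral_gaussVec_eval v j (f := fun t => t) measurable_id]
  simp

lemma integrable_linForm_mul (v : NNReal) (u u' : κ → ℝ) :
    Integrable (fun w : κ → ℝ => (∑ j, w j * u j) * ∑ j, w j * u' j) (gaussVec κ v) :=
  (memLp_linForm v u 2 (by simp)).integrable_mul (memLp_linForm v u' 2 (by simp))

lemma linForm_mul [DecidableEq κ] (v : NNReal) (u u' w : κ → ℝ) :
    (∑ j, w j * u j) * ∑ j, w j * u' j =
      (∑ c, ∑ d, (u c * u' d) * centredProd v c d w) + v * ∑ j, u j * u' j := by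
  rw [sum_centredProd, sub_add_cancel, Finset.sum_mul_sum]
  refine Finset.sum_congr rfl fun c _ => Finset.sum_congr rfl fun d _ => by ring

lemma integral_linForm_mul (v : NNReal) (u u' : κ → ℝ) :
    ∫ w : κ → ℝ, (∑ j, w j * u j) * ∑ j, w j * u' j ∂(gaussVec κ v) =
      v * ∑ j, u j * u' j := by
  classical
  simp_rw [linForm_mul v u u']
  have hi : ∀ c d : κ, Integrable (fun w => (u c * u' d) * centredProd v c d w) (gaussVec κ v) :=
    fun c d => ((memLp_centredProd v c d).integrable (by norm_num)).const_mul _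
  rw [integral_add (integrable_finsetSum _ fun c _ => integrable_finsetSum _ fun d _ => hi c d)
    (integrable_const _), integral_finsetSum _ fun c _ => integrable_finsetSum _ fun d _ => hi c d]
  have : ∀ c, ∫ w, ∑ d, (u c * u' d) * centredProd v c d w ∂(gaussVec κ v) = 0 := by
    intro c
    rw [integral_finsetSum _ fun d _ => hi c d]
    simp [integral_const_mul, integral_centredProd]
  simp [this]

/-- The constant in the second-moment bounds for quadratic forms. -/
def quadConst : ℝ := 2 * prodConst

lemma two_le_prodConst : 2 ≤ prodConst := by
  have := gaussFourth_nonneg; unfold prodConst; linarith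

lemma quadConst_pos : 0 < quadConst := by
  have := two_le_prodConst; unfold quadConst; linarith

lemma meanLE_quadForm_sq [DecidableEq κ] (v : NNReal) (A : κ → κ → ℝ) :
    MeanLE (gaussVec κ v)
      (fun w => ((∑ c, ∑ d, w c * A c d * w d) - v * ∑ c, A c c) ^ 2)
      (quadConst * (v : ℝ) ^ 2 * ∑ c, ∑ d, A c d ^ 2) := by
  simp_rw [← sum_centredProd]
  refine meanLE_of_integral_le ?_ (fun _ => sq_nonneg _) (memLp_quadForm v A).integrable_sq
    (integral_quadForm_sq_le v A)
  unfold centredProd; fun_prop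

/-- The constant in the fourth-moment bound for linear forms. -/
def linConst : ℝ := 2 * quadConst + 2

lemma linConst_pos : 0 < linConst := by
  have := quadConst_pos; unfold linConst; linarith

lemma meanLE_linForm_pow_four (v : NNReal) (u : κ → ℝ) :
    MeanLE (gaussVec κ v) (fun w => (∑ j, w j * u j) ^ 4)
      (linConst * (v : ℝ) ^ 2 * (∑ j, u j ^ 2) ^ 2) := by
  classical
  have h := ((meanLE_quadForm_sq v fun c d => u c * u d).const_mul (c := 2) (by norm_num)).add
    (MeanLE.const (μ := gaussVec κ v) (C := 2 * ((v : ℝ) * ∑ c, u c * u c) ^ 2) (by positivity))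
  refine h.mono (by fun_prop) (fun w => ?_) (le_of_eq ?_)
  · have : ∑ c, ∑ d, w c * (u c * u d) * w d = (∑ j, w j * u j) ^ 2 := by
      rw [pow_two, Finset.sum_mul_sum]
      refine Finset.sum_congr rfl fun c _ => Finset.sum_congr rfl fun d _ => by ring
    rw [this]
    nlinarith [sq_nonneg ((∑ j, w j * u j) ^ 2 - 2 * ((v : ℝ) * ∑ c, u c * u c))]
  · have : ∑ c, ∑ d, (u c * u d) ^ 2 = (∑ j, u j ^ 2) ^ 2 := by
      rw [pow_two (∑ j, u j ^ 2), Finset.sum_mul_sum]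
      refine Finset.sum_congr rfl fun c _ => Finset.sum_congr rfl fun d _ => by ring
    rw [this]
    simp only [← pow_two, linConst]
    ring

lemma meanLE_bilinForm_sq [DecidableEq ι] (v : NNReal) (A : κ → κ → ℝ) (a b : ι) :
    MeanLE (gaussMat ι κ v)
      (fun W => ((∑ c, ∑ d, W a c * A c d * W b d) -
        if a = b then v * ∑ c, A c c else 0) ^ 2)
      (quadConst * (v : ℝ) ^ 2 * ∑ c, ∑ d, A c d ^ 2) := by
  classical
  by_cases hab : a = b
  · subst hab
    simp only [if_true]
    exact (meanLE_quadForm_sq v A).comp_measurePreserving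
      (measurePreserving_eval (fun _ => gaussVec κ v) a)
  simp only [if_neg hab, sub_zero]
  have hlin : ∀ u : κ → ℝ, MeanLE (gaussVec κ v) (fun w => (∑ j, w j * u j) ^ 2)
      (v * ∑ j, u j ^ 2) := fun u =>
    meanLE_of_integral_le (by fun_prop) (fun _ => sq_nonneg _)
      (memLp_linForm v u 2 (by simp)).integrable_sq (by
        have := integral_linForm_mul v u u
        simp only [← pow_two] at this
        exact this.le)
  have hrow : MeanLE (gaussMat ι κ v)
      (fun W => v * ∑ c, (∑ d, W b d * A c d) ^ 2) (v * ∑ c, (v * ∑ d, A c d ^ 2)) :=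
    ((MeanLE.sum Finset.univ fun c _ => hlin (A c)).const_mul v.coe_nonneg).comp_measurePreserving
      (measurePreserving_eval (fun _ => gaussVec κ v) b)
  refine MeanLE.mono (MeanLE.of_update _ a (by fun_prop) hrow fun W => ?_)
    (by fun_prop) (fun W => le_rfl) ?_
  · have := hlin fun c => ∑ d, W b d * A c d
    refine this.mono ?_ (fun w => ?_) le_rfl
    · simp only [Function.update_self, Function.update_of_ne (Ne.symm hab)]
      fun_prop
    · simp only [Function.update_self, Function.update_of_ne (Ne.symm hab)]
      refine le_of_eq ?_
      congr 1
      refine Finset.sum_congr rfl fun c _ => ?_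
      rw [Finset.mul_sum]
      refine Finset.sum_congr rfl fun d _ => by ring
  · rw [← Finset.mul_sum, ← mul_assoc, ← pow_two]
    have h1 : (1 : ℝ) ≤ quadConst := by
      have := two_le_prodConst; unfold quadConst; linarith
    gcongr
    nlinarith [sq_nonneg (v : ℝ)]

/-- The Gaussian covariance of two rectified linear forms. -/
def reluCov (v : NNReal) (u u' : κ → ℝ) : ℝ :=
  ∫ w : κ → ℝ, relu (∑ j, w j * u j) * relu (∑ j, w j * u' j) ∂(gaussVec κ v)

lemma integrable_linForm_pow_four (v : NNReal) (u : κ → ℝ) :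
    Integrable (fun w : κ → ℝ => (∑ j, w j * u j) ^ 4) (gaussVec κ v) := by
  have h := (memLp_linForm v u 4 (by simp)).integrable_norm_pow'
  refine (integrable_norm_iff (Continuous.aestronglyMeasurable (by fun_prop))).1 ?_
  simpa using h

lemma memLp_relu_mul_relu (v : NNReal) (u u' : κ → ℝ) :
    MemLp (fun w : κ → ℝ => relu (∑ j, w j * u j) * relu (∑ j, w j * u' j)) 2 (gaussVec κ v) := by
  have hc : Continuous fun w : κ → ℝ => relu (∑ j, w j * u j) * relu (∑ j, w j * u' j) :=
    (continuous_relu.comp (by fun_prop)).mul (continuous_relu.comp (by fun_prop))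
  rw [memLp_two_iff_integrable_sq hc.aestronglyMeasurable]
  refine ((integrable_linForm_pow_four v u).add (integrable_linForm_pow_four v u')).mono'
    (hc.pow 2).aestronglyMeasurable (ae_of_all _ fun w => ?_)
  rw [Real.norm_of_nonneg (sq_nonneg _), mul_pow]
  have h1 := mul_le_mul (relu_sq_le (∑ j, w j * u j)) (relu_sq_le (∑ j, w j * u' j))
    (sq_nonneg _) (sq_nonneg _)
  refine h1.trans ?_
  simp only [Pi.add_apply]
  nlinarith [sq_nonneg ((∑ j, w j * u j) ^ 2 - (∑ j, w j * u' j) ^ 2),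
    sq_nonneg ((∑ j, w j * u j) ^ 2), sq_nonneg ((∑ j, w j * u' j) ^ 2)]

lemma integral_linForm_pow_four_le (v : NNReal) (u : κ → ℝ) :
    ∫ w : κ → ℝ, (∑ j, w j * u j) ^ 4 ∂(gaussVec κ v) ≤
      linConst * (v : ℝ) ^ 2 * (∑ j, u j ^ 2) ^ 2 := by
  have h := meanLE_linForm_pow_four v u
  have h2 := h.2.2
  rw [← ofReal_integral_eq_lintegral_ofReal (integrable_linForm_pow_four v u)
    (ae_of_all _ fun w => by positivity)] at h2
  exact (ENNReal.ofReal_le_ofReal_iff h.2.1).1 h2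

lemma meanLE_sum_relu_sub_sq (v : NNReal) (u u' : κ → ℝ) :
    MeanLE (gaussMat ι κ v)
      (fun W => ((∑ a, relu (∑ j, W a j * u j) * relu (∑ j, W a j * u' j)) -
        Fintype.card ι * reluCov v u u') ^ 2)
      (Fintype.card ι * (linConst * (v : ℝ) ^ 2 *
        ((∑ j, u j ^ 2) ^ 2 + (∑ j, u' j ^ 2) ^ 2))) := by
  have hL := memLp_relu_mul_relu v u u'
  set ψ : (κ → ℝ) → ℝ := fun w => relu (∑ j, w j * u j) * relu (∑ j, w j * u' j) with hψ
  have hcψ : Continuous ψ :=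
    (continuous_relu.comp (by fun_prop)).mul (continuous_relu.comp (by fun_prop))
  have hLa : ∀ a : ι, MemLp (fun W : ι → κ → ℝ => ψ (W a)) 2 (gaussMat ι κ v) := fun a =>
    hL.comp_measurePreserving (measurePreserving_eval (fun _ => gaussVec κ v) a)
  have hLs : MemLp (∑ a : ι, fun W : ι → κ → ℝ => ψ (W a)) 2 (gaussMat ι κ v) :=
    memLp_finsetSum' _ fun a _ => hLa a
  have hvar := variance_sum_pi (μ := fun _ : ι => gaussVec κ v) (X := fun _ => ψ) fun _ => hL
  have hmean : ∫ W, (∑ a : ι, fun W : ι → κ → ℝ => ψ (W a)) W ∂(gaussMat ι κ v) =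
      Fintype.card ι * reluCov v u u' := by
    simp only [Finset.sum_apply]
    rw [integral_finsetSum _ fun a _ => (hLa a).integrable (by norm_num)]
    have : ∀ a : ι, ∫ W : ι → κ → ℝ, ψ (W a) ∂(gaussMat ι κ v) = reluCov v u u' := by
      intro a
      have h := measurePreserving_eval (fun _ : ι => gaussVec κ v) a
      rw [reluCov, ← h.map_eq,
        integral_map h.measurable.aemeasurable hcψ.measurable.aestronglyMeasurable]
    simp [this]
  rw [variance_eq_integral hLs.aemeasurable, hmean] at hvar
  refine meanLE_of_integral_le ?_ (fun _ => sq_nonneg _) ?_ ?_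
  · refine ((Finset.measurable_sum _ fun a _ => ?_).sub_const _).pow_const 2
    exact hcψ.measurable.comp (measurable_pi_apply a)
  · have := (hLs.sub (memLp_const (Fintype.card ι * reluCov v u u'))).integrable_sq
    simpa using this
  · simp only [Finset.sum_apply] at hvar
    refine hvar.le.trans ?_
    rw [Finset.sum_const, Finset.card_univ, nsmul_eq_mul]
    gcongr
    refine (variance_le_expectation_sq hcψ.measurable.aestronglyMeasurable).trans ?_
    calc ∫ w, (ψ ^ 2) w ∂(gaussVec κ v)
        ≤ ∫ w, ((∑ j, w j * u j) ^ 4 + (∑ j, w j * u' j) ^ 4) ∂(gaussVec κ v) := by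
          refine integral_mono hL.integrable_sq
            ((integrable_linForm_pow_four v u).add (integrable_linForm_pow_four v u')) fun w => ?_
          simp only [Pi.pow_apply, hψ, mul_pow]
          have h1 := mul_le_mul (relu_sq_le (∑ j, w j * u j)) (relu_sq_le (∑ j, w j * u' j))
            (sq_nonneg _) (sq_nonneg _)
          refine h1.trans ?_
          nlinarith [sq_nonneg ((∑ j, w j * u j) ^ 2 - (∑ j, w j * u' j) ^ 2),
            sq_nonneg ((∑ j, w j * u j) ^ 2), sq_nonneg ((∑ j, w j * u' j) ^ 2)]
      _ ≤ _ := by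
          rw [integral_add (integrable_linForm_pow_four v u) (integrable_linForm_pow_four v u')]
          have h1 := integral_linForm_pow_four_le v u
          have h2 := integral_linForm_pow_four_le v u'
          linarith

lemma meanLE_sum_relu_sq_sq (v : NNReal) (u : κ → ℝ) :
    MeanLE (gaussMat ι κ v)
      (fun W => (∑ a, relu (∑ j, W a j * u j) ^ 2) ^ 2)
      ((Fintype.card ι : ℝ) ^ 2 * (linConst * (v : ℝ) ^ 2 * (∑ j, u j ^ 2) ^ 2)) := by
  have h := fun a : ι => (meanLE_linForm_pow_four v u).comp_measurePreserving
      (measurePreserving_eval (fun _ : ι => gaussVec κ v) a)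
  have h2 := (MeanLE.sum_univ h).const_mul
    (c := Fintype.card ι) (by positivity)
  refine h2.mono ?_ (fun W => ?_) (le_of_eq (by ring))
  · refine (Finset.measurable_sum _ fun a _ => ?_).pow_const 2
    exact (measurable_relu.comp (by fun_prop)).pow_const 2
  · have h3 := sq_sum_le_card_mul_sum_sq (s := Finset.univ)
      (f := fun a => relu (∑ j, W a j * u j) ^ 2)
    refine h3.trans ?_
    rw [Finset.card_univ]
    gcongr with a
    calc (relu (∑ j, W a j * u j) ^ 2) ^ 2 ≤ ((∑ j, W a j * u j) ^ 2) ^ 2 := by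
          exact pow_le_pow_left₀ (sq_nonneg _) (relu_sq_le _) 2
      _ = _ := by simp [← pow_mul]

lemma half_inner_le_reluCov (v : NNReal) (u u' : κ → ℝ) :
    (v / 2 : ℝ) * ∑ j, u j * u' j ≤ reluCov v u u' := by
  have hneg : MeasurePreserving (fun (w : κ → ℝ) i => -w i) (gaussVec κ v) (gaussVec κ v) :=
    measurePreserving_pi _ _ fun _ => 
      ⟨measurable_neg, by simpa using gaussianReal_map_neg (μ := 0) (v := v)⟩
  have hi := (memLp_relu_mul_relu v u u').integrable (by norm_num)
  have hi2 := hneg.integrable_comp_of_integrable hi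
  have hc : Continuous fun w : κ → ℝ => relu (∑ j, w j * u j) * relu (∑ j, w j * u' j) :=
    (continuous_relu.comp (by fun_prop)).mul (continuous_relu.comp (by fun_prop))
  have heq : ∫ w : κ → ℝ, relu (∑ j, -w j * u j) * relu (∑ j, -w j * u' j) ∂(gaussVec κ v) =
      reluCov v u u' := by
    rw [reluCov]
    conv_rhs => rw [← hneg.map_eq]
    rw [integral_map hneg.measurable.aemeasurable hc.measurable.aestronglyMeasurable]
  have h2 : ∫ w : κ → ℝ, (∑ j, w j * u j) * ∑ j, w j * u' j ∂(gaussVec κ v) ≤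
      reluCov v u u' + reluCov v u u' := by
    nth_rewrite 2 [← heq]
    refine le_of_le_of_eq ?_ (integral_add hi hi2)
    refine integral_mono (integrable_linForm_mul v u u') (hi.add hi2) fun w => ?_
    simp only [neg_mul, Finset.sum_neg_distrib]
    generalize (∑ j, w j * u j) = x
    generalize (∑ j, w j * u' j) = y
    unfold relu
    rcases le_total x 0 with hx | hx <;> rcases le_total y 0 with hy | hy <;>
      simp [hx, hy] <;> nlinarith
  rw [integral_linForm_mul] at h2
  linarith

end GaussianForms

section ReluCovariance

variable {κ : Type*} [Fintype κ]

lemma reluCov_pos {v : NNReal} (hv : v ≠ 0) (u u' : κ → ℝ)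
    (h : ∃ w : κ → ℝ, 0 < ∑ j, w j * u j ∧ 0 < ∑ j, w j * u' j) : 0 < reluCov v u u' := by
  have : (gaussianReal 0 v).IsOpenPosMeasure :=
    (gaussianReal_absolutelyContinuous' 0 hv).isOpenPosMeasure
  rw [reluCov, integral_pos_iff_support_of_nonneg
    (fun w => mul_nonneg (relu_nonneg _) (relu_nonneg _))
    ((memLp_relu_mul_relu v u u').integrable (by norm_num))]
  have hc (z : κ → ℝ) : Continuous fun w : κ → ℝ => ∑ j, w j * z j := by fun_prop
  have ho : IsOpen {w : κ → ℝ | 0 < ∑ j, w j * u j ∧ 0 < ∑ j, w j * u' j} :=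
    (isOpen_lt continuous_const (hc u)).inter (isOpen_lt continuous_const (hc u'))
  refine (ho.measure_pos (gaussVec κ v) h).trans_le (measure_mono ?_)
  rintro w ⟨h1, h2⟩
  simp only [Function.mem_support, relu]
  rw [max_eq_left h1.le, max_eq_left h2.le]
  positivity

/-- The mean of a rectified standard Gaussian. -/
def reluMean : ℝ := ∫ t, relu t ∂(gaussianReal 0 1)

lemma integrable_relu (v : NNReal) : Integrable relu (gaussianReal 0 v) := by
  refine ((memLp_id_gaussianReal' (μ := 0) (v := v) 1 (by simp)).integrable le_rfl).mono
    continuous_relu.aestronglyMeasurable (ae_of_all _ fun t => ?_)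
  simp only [Real.norm_eq_abs, id]
  exact sq_le_sq.1 (relu_sq_le t)

lemma reluMean_pos : 0 < reluMean := by
  have : (gaussianReal 0 1).IsOpenPosMeasure :=
    (gaussianReal_absolutelyContinuous' 0 one_ne_zero).isOpenPosMeasure
  rw [reluMean, integral_pos_iff_support_of_nonneg relu_nonneg (integrable_relu 1)]
  refine (isOpen_Ioi.measure_pos (gaussianReal 0 1) (Set.nonempty_Ioi (a := (0 : ℝ)))).trans_le
    (measure_mono fun t ht => ?_)
  have h : (0 : ℝ) < t := ht
  simp only [Function.mem_support, relu, max_eq_left h.le]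
  exact h.ne'

lemma relu_mul {c : ℝ} (hc : 0 ≤ c) (t : ℝ) : relu (c * t) = c * relu t := by
  unfold relu; rw [mul_max_of_nonneg _ _ hc, mul_zero]

lemma integral_relu_gaussianReal (v : NNReal) :
    ∫ t, relu t ∂(gaussianReal 0 v) = Real.sqrt v * reluMean := by
  have h := gaussianReal_map_const_mul (μ := 0) (v := 1) (Real.sqrt v)
  have hv : (NNReal.mk (Real.sqrt v ^ 2) (sq_nonneg _) * 1 : NNReal) = v := by
    ext; simp
  rw [hv, mul_zero] at h
  rw [← h, integral_map (by fun_prop) continuous_relu.aestronglyMeasurable]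
  simp_rw [relu_mul (Real.sqrt_nonneg _)]
  rw [integral_const_mul, reluMean]

lemma hasGaussianLaw_linForms (v : NNReal) (u u' : κ → ℝ) :
    HasGaussianLaw (fun w : κ → ℝ => (∑ j, w j * u j, ∑ j, w j * u' j)) (gaussVec κ v) := by
  have h := (hasGaussianLaw_gaussVec (ι := κ) v).map_fun
    ((∑ j, (u j) • ContinuousLinearMap.proj (R := ℝ) (φ := fun _ : κ => ℝ) j).prod
      (∑ j, (u' j) • ContinuousLinearMap.proj (R := ℝ) (φ := fun _ : κ => ℝ) j))
  refine h.congr (ae_of_all _ fun w => ?_)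
  simp [mul_comm]

lemma map_linForm (v : NNReal) (u : κ → ℝ) :
    (gaussVec κ v).map (fun w => ∑ j, w j * u j) =
      gaussianReal 0 (v * ∑ j, u j ^ 2).toNNReal := by
  have h := (hasGaussianLaw_linForms v u u).fst
  rw [h.map_eq_gaussianReal, integral_linForm,
    variance_of_integral_eq_zero (memLp_linForm v u 1 (by simp)).1.aemeasurable
      (integral_linForm v u)]
  have := integral_linForm_mul v u u
  simp only [← pow_two] at this
  rw [this]

lemma integral_relu_linForm (v : NNReal) (u : κ → ℝ) :
    ∫ w : κ → ℝ, relu (∑ j, w j * u j) ∂(gaussVec κ v) =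
      Real.sqrt (v * ∑ j, u j ^ 2) * reluMean := by
  have hm : Measurable fun w : κ → ℝ => ∑ j, w j * u j := by fun_prop
  rw [← integral_map hm.aemeasurable continuous_relu.aestronglyMeasurable, map_linForm,
    integral_relu_gaussianReal, Real.coe_toNNReal _ (by positivity)]

lemma reluCov_of_orthogonal (v : NNReal) (u u' : κ → ℝ) (h : ∑ j, u j * u' j = 0) :
    reluCov v u u' =
      (Real.sqrt (v * ∑ j, u j ^ 2) * reluMean) * (Real.sqrt (v * ∑ j, u' j ^ 2) * reluMean) := by
  have hind : (fun w : κ → ℝ => ∑ j, w j * u j) ⟂ᵢ[gaussVec κ v] (fun w => ∑ j, w j * u' j) := by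
    refine (hasGaussianLaw_linForms v u u').indepFun_of_covariance_eq_zero ?_
    rw [covariance_eq_sub (memLp_linForm v u 2 (by simp)) (memLp_linForm v u' 2 (by simp)),
      integral_linForm, zero_mul, sub_zero]
    refine (integral_linForm_mul v u u').trans ?_
    rw [h, mul_zero]
  have h2 := hind.comp measurable_relu measurable_relu
  rw [← integral_relu_linForm, ← integral_relu_linForm]
  have hc : ∀ u : κ → ℝ, Continuous fun w : κ → ℝ => relu (∑ j, w j * u j) := fun u =>
    continuous_relu.comp (by fun_prop)
  exact h2.integral_fun_mul_eq_mul_integral (hc u).measurable.aestronglyMeasurable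
    (hc u').measurable.aestronglyMeasurable

/-- A linear form with a nonzero coefficient vector almost surely does not vanish. -/
lemma ae_linForm_ne_zero {v : NNReal} (hv : v ≠ 0) {u : κ → ℝ} (hu : u ≠ 0) :
    ∀ᵐ w ∂(gaussVec κ v), ∑ j, w j * u j ≠ 0 := by
  have hm : Measurable fun w : κ → ℝ => ∑ j, w j * u j := by fun_prop
  have hpos : 0 < (v : ℝ) * ∑ j, u j ^ 2 := by
    obtain ⟨j, hj⟩ := Function.ne_iff.1 hu
    have hj' : u j ≠ 0 := hj
    have : 0 < ∑ j, u j ^ 2 :=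
      Finset.sum_pos' (fun _ _ => sq_nonneg _) ⟨j, Finset.mem_univ j, by positivity⟩
    have : (0 : ℝ) < v := by positivity
    positivity
  have hne : (v * ∑ j, u j ^ 2 : ℝ).toNNReal ≠ 0 := by simpa using hpos
  have hna := nullSingletonClass_gaussianReal (μ := 0) hne
  have h0 : ∀ᵐ t ∂((gaussVec κ v).map fun w => ∑ j, w j * u j), t ≠ 0 := by
    rw [map_linForm]
    exact Measure.ae_ne _ _
  exact ae_of_ae_map hm.aemeasurable h0

end ReluCovariance

section Kernels

/-- The derivative of the ReLU away from `0`, with value `0` at `0`. -/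
def gate (t : ℝ) : ℝ := if 0 < t then 1 else 0

lemma gate_nonneg (t : ℝ) : 0 ≤ gate t := by unfold gate; split_ifs <;> norm_num

lemma gate_le_one (t : ℝ) : gate t ≤ 1 := by unfold gate; split_ifs <;> norm_num

lemma measurable_gate : Measurable gate :=
  Measurable.ite measurableSet_Ioi measurable_const measurable_const

variable (w : ℕ → ℕ)

/-- The inner product of the layer-`l` activations at two inputs. -/
def actKer (θ : (l : ℕ) → Fin (w (l + 1)) → Fin (w l) → ℝ) (l : ℕ) (x x' : Fin (w 0) → ℝ) : ℝ :=
  ∑ j, layerOut w θ l x j * layerOut w θ l x' j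

/-- The squared norm of the layer-`l` activations. -/
def actSq (θ : (l : ℕ) → Fin (w (l + 1)) → Fin (w l) → ℝ) (l : ℕ) (x : Fin (w 0) → ℝ) : ℝ :=
  ∑ j, layerOut w θ l x j ^ 2

/-- The tangent kernel of the layer-`l` pre-activations, given by its layerwise recursion. -/
def preKer (θ : (l : ℕ) → Fin (w (l + 1)) → Fin (w l) → ℝ) (x x' : Fin (w 0) → ℝ) :
    (l : ℕ) → Fin (w l) → Fin (w l) → ℝ
  | 0 => 0
  | l + 1 => fun a b => (if a = b then actKer w θ l x x' else 0) +
      ∑ c, ∑ d, θ l a c *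
        (gate (netOut w θ l x c) * preKer θ x x' l c d * gate (netOut w θ l x' d)) * θ l b d

/-- The tangent kernel of the layer-`l` activations. -/
def postKer (θ : (l : ℕ) → Fin (w (l + 1)) → Fin (w l) → ℝ) (x x' : Fin (w 0) → ℝ)
    (l : ℕ) (c d : Fin (w l)) : ℝ :=
  gate (netOut w θ l x c) * preKer w θ x x' l c d * gate (netOut w θ l x' d)

variable {w} {θ θ' : (l : ℕ) → Fin (w (l + 1)) → Fin (w l) → ℝ} {x x' : Fin (w 0) → ℝ}

lemma preKer_succ (l : ℕ) (a b : Fin (w (l + 1))) :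
    preKer w θ x x' (l + 1) a b = (if a = b then actKer w θ l x x' else 0) +
      ∑ c, ∑ d, θ l a c * postKer w θ x x' l c d * θ l b d := rfl

@[simp] lemma preKer_zero : preKer w θ x x' 0 = 0 := rfl

@[simp] lemma postKer_zero : postKer w θ x x' 0 = 0 := by
  ext c d; simp [postKer]

lemma netOut_succ (l : ℕ) (i : Fin (w (l + 1))) :
    netOut w θ (l + 1) x i = ∑ j, θ l i j * layerOut w θ l x j := rfl

lemma layerOut_succ (l : ℕ) (i : Fin (w (l + 1))) :
    layerOut w θ (l + 1) x i = relu (∑ j, θ l i j * layerOut w θ l x j) := rfl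

lemma layerOut_succ_eq_relu (l : ℕ) (i : Fin (w (l + 1))) :
    layerOut w θ (l + 1) x i = relu (netOut w θ (l + 1) x i) := rfl

lemma abs_postKer_le (l : ℕ) (c d : Fin (w l)) :
    |postKer w θ x x' l c d| ≤ |preKer w θ x x' l c d| := by
  rw [postKer, abs_mul, abs_mul, abs_of_nonneg (gate_nonneg _), abs_of_nonneg (gate_nonneg _)]
  have h1 := gate_le_one (netOut w θ l x c)
  have h2 := gate_le_one (netOut w θ l x' d)
  calc _ ≤ 1 * |preKer w θ x x' l c d| * 1 := by
        gcongr
        exact gate_nonneg _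
    _ = _ := by ring

lemma postKer_sq_le (l : ℕ) (c d : Fin (w l)) :
    postKer w θ x x' l c d ^ 2 ≤ preKer w θ x x' l c d ^ 2 :=
  sq_le_sq.2 (abs_postKer_le l c d)

lemma actKer_self (l : ℕ) : actKer w θ l x x = actSq w θ l x := by
  simp [actKer, actSq, sq]

lemma actKer_succ_nonneg (l : ℕ) : 0 ≤ actKer w θ (l + 1) x x' :=
  Finset.sum_nonneg fun _ _ => mul_nonneg (relu_nonneg _) (relu_nonneg _)

lemma actKer_sq_le (l : ℕ) :
    actKer w θ l x x' ^ 2 ≤ actSq w θ l x ^ 2 + actSq w θ l x' ^ 2 := by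
  have h := Finset.sum_mul_sq_le_sq_mul_sq Finset.univ (layerOut w θ l x) (layerOut w θ l x')
  have : actKer w θ l x x' ^ 2 ≤ actSq w θ l x * actSq w θ l x' := h
  nlinarith [sq_nonneg (actSq w θ l x - actSq w θ l x'), sq_nonneg (actSq w θ l x),
    sq_nonneg (actSq w θ l x')]

lemma layerOut_congr (l : ℕ) (h : ∀ k < l, θ k = θ' k) :
    layerOut w θ l x = layerOut w θ' l x := by
  induction l with
  | zero => rfl
  | succ l ih =>
    ext i
    simp only [layerOut_succ, ih fun k hk => h k (by lia), h l (by lia)]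

lemma netOut_congr (l : ℕ) (h : ∀ k < l, θ k = θ' k) :
    netOut w θ l x = netOut w θ' l x := by
  cases l with
  | zero => rfl
  | succ l =>
    ext i
    simp only [netOut_succ, layerOut_congr l fun k hk => h k (by lia), h l (by lia)]

lemma actKer_congr (l : ℕ) (h : ∀ k < l, θ k = θ' k) :
    actKer w θ l x x' = actKer w θ' l x x' := by
  simp only [actKer, layerOut_congr l h]

lemma preKer_congr (l : ℕ) (h : ∀ k < l, θ k = θ' k) :
    preKer w θ x x' l = preKer w θ' x x' l := by
  induction l with
  | zero => rfl
  | succ l ih =>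
    have h' : ∀ k < l, θ k = θ' k := fun k hk => h k (by lia)
    ext a b
    simp only [preKer_succ, postKer, ih h', netOut_congr l h', h l (by lia), actKer_congr l h']

lemma postKer_congr (l : ℕ) (h : ∀ k < l, θ k = θ' k) :
    postKer w θ x x' l = postKer w θ' x x' l := by
  ext c d
  simp only [postKer, preKer_congr l h, netOut_congr l h]

end Kernels

section Parameters

variable {L : ℕ} {w : ℕ → ℕ}

lemma extParams_update_self (θ : Params L w) (l : Fin L) (W) :
    extParams (Function.update θ l W) l = W := by
  simp [extParams]

lemma extParams_update_of_lt (θ : Params L w) (l : Fin L) (W) :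
    ∀ k < (l : ℕ), extParams (Function.update θ l W) k = extParams θ k := by
  intro k hk
  have hkL : k < L := hk.trans l.2
  have : (⟨k, hkL⟩ : Fin L) ≠ l := by
    rintro rfl
    simp at hk
  simp [extParams, hkL, this]

@[fun_prop]
lemma measurable_extParams (l : ℕ) (i : Fin (w (l + 1))) (j : Fin (w l)) :
    Measurable fun θ : Params L w => extParams θ l i j := by
  by_cases h : l < L
  · simp only [extParams, h, dite_true]
    fun_prop
  · simp only [extParams, h, dite_false]
    exact measurable_const

@[fun_prop]
lemma measurable_layerOut (l : ℕ) (x : Fin (w 0) → ℝ) (i : Fin (w l)) :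
    Measurable fun θ : Params L w => layerOut w (extParams θ) l x i := by
  induction l with
  | zero => exact measurable_const
  | succ l ih =>
    simp only [layerOut_succ]
    exact measurable_relu.comp
      (Finset.measurable_fun_sum _ fun j _ => (measurable_extParams l i j).mul (ih j))

@[fun_prop]
lemma measurable_netOut (l : ℕ) (x : Fin (w 0) → ℝ) (i : Fin (w l)) :
    Measurable fun θ : Params L w => netOut w (extParams θ) l x i := by
  cases l with
  | zero => exact measurable_const
  | succ l =>
    simp only [netOut_succ]
    fun_prop

@[fun_prop]
lemma measurable_actKer (l : ℕ) (x x' : Fin (w 0) → ℝ) :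
    Measurable fun θ : Params L w => actKer w (extParams θ) l x x' := by
  unfold actKer
  fun_prop

@[fun_prop]
lemma measurable_actSq (l : ℕ) (x : Fin (w 0) → ℝ) :
    Measurable fun θ : Params L w => actSq w (extParams θ) l x := by
  unfold actSq
  fun_prop

@[fun_prop]
lemma measurable_preKer (l : ℕ) (x x' : Fin (w 0) → ℝ) (a b : Fin (w l)) :
    Measurable fun θ : Params L w => preKer w (extParams θ) x x' l a b := by
  induction l with
  | zero => exact measurable_const
  | succ l ih =>
    simp only [preKer_succ, postKer]
    have hg (y : Fin (w 0) → ℝ) (c : Fin (w l)) :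
        Measurable fun θ : Params L w => gate (netOut w (extParams θ) l y c) :=
      measurable_gate.comp (measurable_netOut l y c)
    refine Measurable.add ?_ (Finset.measurable_fun_sum _ fun c _ =>
      Finset.measurable_fun_sum _ fun d _ => ((measurable_extParams l a c).mul
        (((hg x c).mul (ih c d)).mul (hg x' d))).mul (measurable_extParams l b d))
    split_ifs
    · exact measurable_actKer l x x'
    · exact measurable_const

@[fun_prop]
lemma measurable_postKer (l : ℕ) (x x' : Fin (w 0) → ℝ) (c d : Fin (w l)) :
    Measurable fun θ : Params L w => postKer w (extParams θ) x x' l c d := by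
  unfold postKer
  exact ((measurable_gate.comp (measurable_netOut l x c)).mul (measurable_preKer l x x' c d)).mul
    (measurable_gate.comp (measurable_netOut l x' d))

instance : IsProbabilityMeasure (initMeasure L w) := by
  unfold initMeasure; infer_instance

lemma initMeasure_eq : initMeasure L w =
    Measure.pi fun l : Fin L =>
      gaussMat (Fin (w (l.val + 1))) (Fin (w l.val)) ((w l.val : NNReal))⁻¹ := rfl

end Parameters

section Gradients

variable {L : ℕ} {w : ℕ → ℕ}

/-- The parameter vector with a single unit entry. -/
def unitParam (l : Fin L) (i : Fin (w (l.val + 1))) (j : Fin (w l.val)) : Params L w :=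
  Pi.single l (Pi.single i (Pi.single j (1 : ℝ)))

lemma unitParam_apply_of_ne {l l' : Fin L} (h : l' ≠ l) (i : Fin (w (l.val + 1)))
    (j : Fin (w l.val)) : (unitParam l i j : Params L w) l' = 0 := by
  simp [unitParam, h]

lemma unitParam_apply_self (l : Fin L) (i a : Fin (w (l.val + 1))) (j b : Fin (w l.val)) :
    (unitParam l i j : Params L w) l a b = if a = i ∧ b = j then 1 else 0 := by
  by_cases h : a = i
  · subst h; simp [unitParam, Pi.single_apply]
  · simp [unitParam, h]

/-- The gradient of a linear functional on the parameters. -/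
def gradVec (φ : Params L w →L[ℝ] ℝ) : Params L w := fun l i j => φ (unitParam l i j)

lemma gradVec_add (φ ψ : Params L w →L[ℝ] ℝ) : gradVec (φ + ψ) = gradVec φ + gradVec ψ := rfl

lemma gradVec_smul (c : ℝ) (φ : Params L w →L[ℝ] ℝ) : gradVec (c • φ) = c • gradVec φ := rfl

lemma gradVec_sum {ι : Type*} (s : Finset ι) (φ : ι → Params L w →L[ℝ] ℝ) :
    gradVec (∑ k ∈ s, φ k) = ∑ k ∈ s, gradVec (φ k) := by
  ext l i j
  simp [gradVec, Finset.sum_apply]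

lemma sum_smul_unitParam (v : Params L w) :
    ∑ l, ∑ i, ∑ j, v l i j • unitParam l i j = v := by
  ext l a b
  simp only [Finset.sum_apply, Pi.smul_apply, smul_eq_mul]
  rw [Finset.sum_eq_single l]
  · simp [unitParam_apply_self, ite_and]
  · intro l' _ h
    simp [unitParam_apply_of_ne (Ne.symm h)]
  · simp

lemma apply_gradVec (φ ψ : Params L w →L[ℝ] ℝ) :
    φ (gradVec ψ) = ∑ l, ∑ i, ∑ j, φ (unitParam l i j) * ψ (unitParam l i j) := by
  conv_lhs => rw [← sum_smul_unitParam (gradVec ψ)]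
  simp [map_sum, gradVec, mul_comm]

lemma apply_gradVec_comm (φ ψ : Params L w →L[ℝ] ℝ) : φ (gradVec ψ) = ψ (gradVec φ) := by
  simp [apply_gradVec, mul_comm]

/-- The coordinate functional of a weight (zero beyond the last layer). -/
def weightCoord (l : ℕ) (i : Fin (w (l + 1))) (j : Fin (w l)) : Params L w →L[ℝ] ℝ :=
  if h : l < L then
    (ContinuousLinearMap.proj j).comp ((ContinuousLinearMap.proj i).comp
      (ContinuousLinearMap.proj (R := ℝ)
        (φ := fun l : Fin L => Fin (w (l.val + 1)) → Fin (w l.val) → ℝ) ⟨l, h⟩))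
  else 0

lemma weightCoord_apply (l : ℕ) (i : Fin (w (l + 1))) (j : Fin (w l)) (θ : Params L w) :
    weightCoord l i j θ = extParams θ l i j := by
  by_cases h : l < L <;> simp [weightCoord, extParams, h]

/-- The derivative of the layer-`l` pre-activations in the parameters. -/
def netDeriv (θ : Params L w) (x : Fin (w 0) → ℝ) : (l : ℕ) → Fin (w l) → Params L w →L[ℝ] ℝ
  | 0, _ => 0
  | l + 1, i => ∑ j, ((extParams θ l i j * gate (netOut w (extParams θ) l x j)) •
      netDeriv θ x l j + layerOut w (extParams θ) l x j • weightCoord l i j)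

lemma netDeriv_succ (θ : Params L w) (x : Fin (w 0) → ℝ) (l : ℕ) (i : Fin (w (l + 1))) :
    netDeriv θ x (l + 1) i =
      ∑ j, ((extParams θ l i j * gate (netOut w (extParams θ) l x j)) •
      netDeriv θ x l j + layerOut w (extParams θ) l x j • weightCoord l i j) := rfl

lemma netDeriv_unitParam_of_le (θ : Params L w) (x : Fin (w 0) → ℝ) (l : ℕ) (k : Fin L)
    (h : l ≤ k) (c : Fin (w l)) (i : Fin (w (k.val + 1))) (j : Fin (w k.val)) :
    netDeriv θ x l c (unitParam k i j) = 0 := by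
  induction l with
  | zero => rfl
  | succ l ih =>
    have hl : l < L := by lia
    have hne : (⟨l, hl⟩ : Fin L) ≠ k := by rintro rfl; simp at h
    simp [netDeriv_succ, ih (by lia), weightCoord_apply, extParams, hl,
      unitParam_apply_of_ne hne]

lemma netDeriv_gradVec (θ : Params L w) (x x' : Fin (w 0) → ℝ) (l : ℕ) (hl : l ≤ L)
    (a b : Fin (w l)) :
    netDeriv θ x l a (gradVec (netDeriv θ x' l b)) = preKer w (extParams θ) x x' l a b := by
  induction l with
  | zero => rfl
  | succ l ih =>
    have hlL : l < L := hl
    have ih := ih hlL.le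
    have hz (y : Fin (w 0) → ℝ) (c : Fin (w l)) (i : Fin (w (l + 1))) (j : Fin (w l)) :
        (weightCoord l i j : Params L w →L[ℝ] ℝ) (gradVec (netDeriv θ y l c)) = 0 := by
      rw [weightCoord_apply, extParams, dif_pos hlL]
      exact netDeriv_unitParam_of_le θ y l ⟨l, hlL⟩ le_rfl c i j
    have hw (i i' : Fin (w (l + 1))) (j j' : Fin (w l)) :
        (weightCoord l i j : Params L w →L[ℝ] ℝ) (gradVec (weightCoord l i' j')) =
          if i = i' ∧ j = j' then 1 else 0 := by
      rw [weightCoord_apply, extParams, dif_pos hlL]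
      change (weightCoord l i' j' : Params L w →L[ℝ] ℝ) (unitParam ⟨l, hlL⟩ i j) = _
      rw [weightCoord_apply, extParams, dif_pos hlL]
      refine (unitParam_apply_self ⟨l, hlL⟩ i i' j j').trans ?_
      simp only [eq_comm]
    rw [netDeriv_succ θ x', gradVec_sum, map_sum, preKer_succ]
    simp only [gradVec_add, gradVec_smul, map_add, map_smul, smul_eq_mul]
    have h1 (d : Fin (w l)) : netDeriv θ x (l + 1) a (gradVec (netDeriv θ x' l d)) =
        ∑ c, extParams θ l a c * gate (netOut w (extParams θ) l x c) *
          preKer w (extParams θ) x x' l c d := by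
      simp [netDeriv_succ, hz, ih]
    have h2 (d : Fin (w l)) :
        netDeriv θ x (l + 1) a (gradVec (weightCoord l b d)) =
          if a = b then layerOut w (extParams θ) l x d else 0 := by
      rw [apply_gradVec_comm, netDeriv_succ, gradVec_sum, map_sum]
      simp [gradVec_add, gradVec_smul, hw, hz, ite_and, eq_comm (a := b)]
    simp only [h1, h2, Finset.sum_add_distrib]
    rw [add_comm]
    congr 1
    · split_ifs
      · exact Finset.sum_congr rfl fun d _ => mul_comm _ _
      · simp
    · rw [Finset.sum_comm]
      refine Finset.sum_congr rfl fun d _ => ?_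
      rw [Finset.mul_sum]
      refine Finset.sum_congr rfl fun c _ => ?_
      rw [postKer]
      ring

end Gradients

section Differentiability

open Filter Topology

variable {L : ℕ} {w : ℕ → ℕ}

lemma hasDerivAt_relu {t : ℝ} (ht : t ≠ 0) : HasDerivAt relu (gate t) t := by
  rcases lt_or_gt_of_ne ht with h | h
  · have : relu =ᶠ[𝓝 t] fun _ => 0 := by
      filter_upwards [eventually_lt_nhds h] with s hs
      exact max_eq_right hs.le
    simpa [gate, h.not_gt] using (hasDerivAt_const t (0 : ℝ)).congr_of_eventuallyEq this
  · have : relu =ᶠ[𝓝 t] id := by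
      filter_upwards [eventually_gt_nhds h] with s hs
      exact max_eq_left hs.le
    simpa [gate, h] using (hasDerivAt_id t).congr_of_eventuallyEq this

@[fun_prop]
lemma continuous_extParams (l : ℕ) (i : Fin (w (l + 1))) (j : Fin (w l)) :
    Continuous fun θ : Params L w => extParams θ l i j := by
  simp only [← weightCoord_apply]
  fun_prop

@[fun_prop]
lemma continuous_layerOut (l : ℕ) (x : Fin (w 0) → ℝ) (i : Fin (w l)) :
    Continuous fun θ : Params L w => layerOut w (extParams θ) l x i := by
  induction l with
  | zero => exact continuous_const
  | succ l ih =>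
    simp only [layerOut_succ]
    exact continuous_relu.comp
      (continuous_finsetSum _ fun j _ => (continuous_extParams l i j).mul (ih j))

@[fun_prop]
lemma continuous_netOut (l : ℕ) (x : Fin (w 0) → ℝ) (i : Fin (w l)) :
    Continuous fun θ : Params L w => netOut w (extParams θ) l x i := by
  cases l with
  | zero => exact continuous_const
  | succ l =>
    simp only [netOut_succ]
    fun_prop

/-- No pre-activation vanishes unless all activations feeding into it do. -/
def Nondegenerate (θ : Params L w) (x : Fin (w 0) → ℝ) : Prop :=
  ∀ l < L, layerOut w (extParams θ) l x ≠ 0 → ∀ c, netOut w (extParams θ) (l + 1) x c ≠ 0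

lemma eventually_layerOut_eq_zero {θ : Params L w} {x : Fin (w 0) → ℝ} {l : ℕ} {c : Fin (w l)}
    (h : netOut w (extParams θ) l x c ≠ 0 ∨
      ∀ᶠ θ' : Params L w in 𝓝 θ, netOut w (extParams θ') l x c = 0)
    (h0 : layerOut w (extParams θ) l x c = 0) :
    ∀ᶠ θ' : Params L w in 𝓝 θ, layerOut w (extParams θ') l x c = 0 := by
  cases l with
  | zero => exact Eventually.of_forall fun _ => h0
  | succ l =>
    simp only [layerOut_succ_eq_relu] at h0 ⊢
    rcases h with h | h
    · have hle : netOut w (extParams θ) (l + 1) x c ≤ 0 := by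
        rw [← h0]; exact le_max_left _ _
      filter_upwards [(continuous_netOut (L := L) (l + 1) x c).continuousAt.eventually
        (eventually_lt_nhds (lt_of_le_of_ne hle h))] with θ' hθ'
      exact max_eq_right hθ'.le
    · filter_upwards [h] with θ' hθ'
      simp [hθ', relu]

lemma Nondegenerate.netOut_ne_zero_or {θ : Params L w} {x : Fin (w 0) → ℝ}
    (h : Nondegenerate θ x) (l : ℕ) (hl : l ≤ L) (c : Fin (w l)) :
    netOut w (extParams θ) l x c ≠ 0 ∨
      ∀ᶠ θ' : Params L w in 𝓝 θ, netOut w (extParams θ') l x c = 0 := by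
  induction l with
  | zero =>
    by_cases hc : x c = 0
    · exact Or.inr (Eventually.of_forall fun _ => hc)
    · exact Or.inl hc
  | succ l ih =>
    by_cases h0 : layerOut w (extParams θ) l x = 0
    · right
      have : ∀ᶠ θ' : Params L w in 𝓝 θ, ∀ j, layerOut w (extParams θ') l x j = 0 :=
        eventually_all.2 fun j =>
          eventually_layerOut_eq_zero (ih (by lia) j) (congrFun h0 j)
      filter_upwards [this] with θ' hθ'
      simp [netOut_succ, hθ']
    · exact Or.inl (h l hl h0 c)

lemma Nondegenerate.hasFDerivAt_netOut {θ : Params L w} {x : Fin (w 0) → ℝ}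
    (h : Nondegenerate θ x) (l : ℕ) (hl : l ≤ L) (c : Fin (w l)) :
    HasFDerivAt (fun θ' : Params L w => netOut w (extParams θ') l x c) (netDeriv θ x l c) θ := by
  induction l with
  | zero => exact hasFDerivAt_const _ _
  | succ l ih =>
    have hlayer (j : Fin (w l)) :
        HasFDerivAt (fun θ' : Params L w => layerOut w (extParams θ') l x j)
          (gate (netOut w (extParams θ) l x j) • netDeriv θ x l j) θ := by
      rcases h.netOut_ne_zero_or l (by lia) j with h1 | h1
      · cases l with
        | zero => exact (hasFDerivAt_const (x j) θ).congr_fderiv (by simp [netDeriv])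
        | succ l => exact (hasDerivAt_relu h1).comp_hasFDerivAt θ (ih (by lia) j)
      · have h0 := h1.self_of_nhds
        cases l with
        | zero => exact (hasFDerivAt_const (x j) θ).congr_fderiv (by simp [netDeriv])
        | succ l =>
          rw [h0]
          simp only [gate, lt_irrefl, if_false, zero_smul]
          refine (hasFDerivAt_const (0 : ℝ) θ).congr_of_eventuallyEq ?_
          filter_upwards [h1] with θ' hθ'
          simp [layerOut_succ_eq_relu, hθ', relu]
    have hw (j : Fin (w l)) : HasFDerivAt (fun θ' : Params L w => extParams θ' l c j)
        (weightCoord l c j) θ := by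
      simp only [← weightCoord_apply]
      exact (weightCoord l c j).hasFDerivAt
    simp only [netOut_succ, netDeriv_succ]
    refine HasFDerivAt.fun_sum fun j _ => ?_
    refine ((hw j).mul (hlayer j)).congr_fderiv ?_
    rw [smul_smul]

lemma Nondegenerate.eNTK_eq {θ : Params L w} {x x' : Fin (w 0) → ℝ}
    (h : Nondegenerate θ x) (h' : Nondegenerate θ x') :
    eNTK L w θ x x' = preKer w (extParams θ) x x' L := by
  ext a b
  rw [← netDeriv_gradVec θ x x' L le_rfl a b, apply_gradVec, eNTK]
  simp only [pderiv, fnet, (h.hasFDerivAt_netOut L le_rfl a).fderiv,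
    (h'.hasFDerivAt_netOut L le_rfl b).fderiv]
  rfl

lemma Nondegenerate.pNTK_eq {θ : Params L w} {x x' : Fin (w 0) → ℝ}
    (h : Nondegenerate θ x) (h' : Nondegenerate θ x') :
    pNTK L w θ x x' = (w L : ℝ)⁻¹ * ∑ a, ∑ b, preKer w (extParams θ) x x' L a b := by
  have hd {y : Fin (w 0) → ℝ} (hy : Nondegenerate θ y) :
      HasFDerivAt (fun θ' : Params L w => (√(w L : ℝ))⁻¹ * ∑ i, netOut w (extParams θ') L y i)
        ((√(w L : ℝ))⁻¹ • ∑ i, netDeriv θ y L i) θ :=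
    (HasFDerivAt.fun_sum fun i _ => hy.hasFDerivAt_netOut L le_rfl i).const_mul _
  have h2 : ((√(w L : ℝ))⁻¹ • ∑ i, netDeriv θ x L i) (gradVec ((√(w L : ℝ))⁻¹ •
      ∑ i, netDeriv θ x' L i)) =
      (w L : ℝ)⁻¹ * ∑ a, ∑ b, preKer w (extParams θ) x x' L a b := by
    simp only [gradVec_smul, gradVec_sum, map_smul, map_sum, FunLike.coe_smul, Pi.smul_apply,
      smul_eq_mul, sum_apply, netDeriv_gradVec θ x x' L le_rfl]
    rw [← Finset.mul_sum, ← mul_assoc, ← mul_inv, Real.mul_self_sqrt (Nat.cast_nonneg _), Finset.sum_comm]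
  rw [← h2, apply_gradVec, pNTK]
  simp only [pderiv, fnet, (hd h).fderiv, (hd h').fderiv]
  rfl

lemma ae_nondegenerate (hw : ∀ l < L, w l ≠ 0) (x : Fin (w 0) → ℝ) :
    ∀ᵐ θ ∂initMeasure L w, Nondegenerate θ x := by
  have key (l : Fin L) (c : Fin (w (l.val + 1))) : ∀ᵐ θ ∂initMeasure L w,
      layerOut w (extParams θ) l x ≠ 0 → netOut w (extParams θ) (l.val + 1) x c ≠ 0 := by
    have hset : MeasurableSet {θ : Params L w | ¬ (layerOut w (extParams θ) l x ≠ 0 →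
        netOut w (extParams θ) (l.val + 1) x c ≠ 0)} := by
      have h1 : MeasurableSet {θ : Params L w | layerOut w (extParams θ) l x = 0} :=
        measurableSet_eq_fun
          (measurable_pi_lambda _ fun j => measurable_layerOut _ x j) measurable_const
      have h2 : MeasurableSet {θ : Params L w | netOut w (extParams θ) (l.val + 1) x c = 0} :=
        measurableSet_eq_fun (measurable_netOut _ x c) measurable_const
      convert h1.compl.inter h2 using 1
      ext θ
      simp [Set.mem_inter_iff]
    rw [ae_iff, ← lintegral_indicator_one hset, initMeasure_eq,
      lintegral_pi_update _ l (measurable_one.indicator hset)]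
    refine (lintegral_congr fun θ => ?_).trans lintegral_zero
    refine (lintegral_congr_ae (g := 0) ?_).trans lintegral_zero
    by_cases h0 : layerOut w (extParams θ) l x = 0
    · refine Eventually.of_forall fun W => ?_
      simp [Set.indicator, layerOut_congr l (extParams_update_of_lt θ l W), h0]
    · have hv : ((w l.val : NNReal))⁻¹ ≠ 0 := by simpa using hw l l.2
      have h1 : ∀ᵐ W ∂gaussMat (Fin (w (l.val + 1))) (Fin (w l.val)) ((w l.val : NNReal))⁻¹,
          ∑ j, W c j * layerOut w (extParams θ) l x j ≠ 0 :=
        (Measure.quasiMeasurePreserving_eval (μ := fun _ : Fin (w (l.val + 1)) =>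
          gaussVec (Fin (w l.val)) ((w l.val : NNReal))⁻¹) c).ae
            (ae_linForm_ne_zero hv h0)
      filter_upwards [h1] with W hW
      simp [Set.indicator, netOut_succ, layerOut_congr l (extParams_update_of_lt θ l W),
        extParams_update_self, hW]
  have : ∀ᵐ θ ∂initMeasure L w, ∀ l : Fin L, ∀ c, layerOut w (extParams θ) l x ≠ 0 →
      netOut w (extParams θ) (l.val + 1) x c ≠ 0 :=
    ae_all_iff.2 fun l => ae_all_iff.2 fun c => key l c
  filter_upwards [this] with θ hθ l hl h0 c
  exact hθ ⟨l, hl⟩ c h0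

end Differentiability

section LayerBounds

variable {L : ℕ} {w : ℕ → ℕ}

lemma extParams_update_mk (θ : Params L w) {l : ℕ} (hl : l < L) (W : Fin (w (l + 1)) → Fin (w l) → ℝ) :
    extParams (Function.update θ ⟨l, hl⟩ W) l = W :=
  extParams_update_self θ ⟨l, hl⟩ W

lemma MeanLE.of_layer {l : ℕ} (hl : l < L) {X Y : Params L w → ℝ} {C : ℝ} (hX : Measurable X)
    (hY : MeanLE (initMeasure L w) Y C)
    (h : ∀ θ, MeanLE (gaussMat (Fin (w (l + 1))) (Fin (w l)) ((w l : NNReal))⁻¹)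
      (fun W => X (Function.update θ ⟨l, hl⟩ W)) (Y θ)) :
    MeanLE (initMeasure L w) X C :=
  MeanLE.of_update (fun l : Fin L =>
    gaussMat (Fin (w (l.val + 1))) (Fin (w l.val)) ((w l.val : NNReal))⁻¹) ⟨l, hl⟩ hX hY h

variable (w) in
/-- The squared Frobenius norm of the pre-activation tangent kernel. -/
def preSq (θ : (l : ℕ) → Fin (w (l + 1)) → Fin (w l) → ℝ) (x x' : Fin (w 0) → ℝ) (l : ℕ) : ℝ :=
  ∑ c, ∑ d, preKer w θ x x' l c d ^ 2

variable (w) in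
/-- The trace of the post-activation tangent kernel. -/
def postTrace (θ : (l : ℕ) → Fin (w (l + 1)) → Fin (w l) → ℝ) (x x' : Fin (w 0) → ℝ)
    (l : ℕ) : ℝ := ∑ c, postKer w θ x x' l c c

variable (w) in
/-- The deviation of the layer-`l + 1` tangent kernel from its conditional mean. -/
def kerFluct (θ : (l : ℕ) → Fin (w (l + 1)) → Fin (w l) → ℝ) (x x' : Fin (w 0) → ℝ) (l : ℕ)
    (a b : Fin (w (l + 1))) : ℝ :=
  (∑ c, ∑ d, θ l a c * postKer w θ x x' l c d * θ l b d) -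
    if a = b then (w l : ℝ)⁻¹ * postTrace w θ x x' l else 0

lemma preKer_succ_eq {θ : (l : ℕ) → Fin (w (l + 1)) → Fin (w l) → ℝ} {x x' : Fin (w 0) → ℝ}
    (l : ℕ) (a b : Fin (w (l + 1))) :
    preKer w θ x x' (l + 1) a b =
      (if a = b then actKer w θ l x x' + (w l : ℝ)⁻¹ * postTrace w θ x x' l else 0) +
        kerFluct w θ x x' l a b := by
  rw [preKer_succ, kerFluct]
  split_ifs <;> ring

lemma sum_postKer_sq_le {θ : (l : ℕ) → Fin (w (l + 1)) → Fin (w l) → ℝ} {x x' : Fin (w 0) → ℝ}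
    (l : ℕ) : ∑ c, ∑ d, postKer w θ x x' l c d ^ 2 ≤ preSq w θ x x' l :=
  Finset.sum_le_sum fun _ _ => Finset.sum_le_sum fun _ _ => postKer_sq_le _ _ _

lemma postTrace_sq_le {θ : (l : ℕ) → Fin (w (l + 1)) → Fin (w l) → ℝ} {x x' : Fin (w 0) → ℝ}
    (l : ℕ) : postTrace w θ x x' l ^ 2 ≤ w l * preSq w θ x x' l := by
  have h1 := sq_sum_le_card_mul_sum_sq (s := Finset.univ)
    (f := fun c => postKer w θ x x' l c c)
  rw [Finset.card_univ, Fintype.card_fin] at h1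
  refine h1.trans (mul_le_mul_of_nonneg_left ?_ (Nat.cast_nonneg _))
  refine le_trans (Finset.sum_le_sum fun c _ => ?_) (sum_postKer_sq_le l)
  exact Finset.single_le_sum (f := fun d => postKer w θ x x' l c d ^ 2)
    (fun _ _ => sq_nonneg _) (Finset.mem_univ c)

variable {x x' : Fin (w 0) → ℝ}

@[fun_prop]
lemma measurable_preSq (l : ℕ) :
    Measurable fun θ : Params L w => preSq w (extParams θ) x x' l := by
  unfold preSq
  fun_prop

@[fun_prop]
lemma measurable_postTrace (l : ℕ) :
    Measurable fun θ : Params L w => postTrace w (extParams θ) x x' l := by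
  unfold postTrace
  fun_prop

@[fun_prop]
lemma measurable_kerFluct (l : ℕ) (a b : Fin (w (l + 1))) :
    Measurable fun θ : Params L w => kerFluct w (extParams θ) x x' l a b := by
  unfold kerFluct
  split_ifs <;> fun_prop

lemma MeanLE.actSq_succ {l : ℕ} (hl : l < L) {C : ℝ}
    (h : MeanLE (initMeasure L w) (fun θ => actSq w (extParams θ) l x ^ 2) C) :
    MeanLE (initMeasure L w) (fun θ => actSq w (extParams θ) (l + 1) x ^ 2)
      ((w (l + 1) : ℝ) ^ 2 * (linConst * ((w l : ℝ)⁻¹) ^ 2 * C)) := by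
  have hc : 0 ≤ (w (l + 1) : ℝ) ^ 2 * (linConst * ((w l : ℝ)⁻¹) ^ 2) := by
    have := linConst_pos
    positivity
  have h' := h.const_mul hc
  rw [mul_assoc] at h'
  refine MeanLE.of_layer hl (by fun_prop) h' fun θ => ?_
  have := meanLE_sum_relu_sq_sq (ι := Fin (w (l + 1))) ((w l : NNReal))⁻¹
    (layerOut w (extParams θ) l x)
  simp only [actSq, layerOut_succ, extParams_update_mk,
    layerOut_congr l (extParams_update_of_lt θ ⟨l, hl⟩ _)]
  simp only [Fintype.card_fin, NNReal.coe_inv, NNReal.coe_natCast] at this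
  simpa only [mul_assoc] using this

lemma MeanLE.kerFluct_sq {l : ℕ} (hl : l < L) {C : ℝ}
    (h : MeanLE (initMeasure L w) (fun θ => preSq w (extParams θ) x x' l) C)
    (a b : Fin (w (l + 1))) :
    MeanLE (initMeasure L w) (fun θ => kerFluct w (extParams θ) x x' l a b ^ 2)
      (quadConst * ((w l : ℝ)⁻¹) ^ 2 * C) := by
  have hc : 0 ≤ quadConst * ((w l : ℝ)⁻¹) ^ 2 := by
    have := quadConst_pos
    positivity
  refine MeanLE.of_layer hl (by fun_prop) (h.const_mul hc) fun θ => ?_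
  have := meanLE_bilinForm_sq ((w l : NNReal))⁻¹ (fun c d => postKer w (extParams θ) x x' l c d) a b
  simp only [kerFluct, postTrace, extParams_update_mk,
    postKer_congr l (extParams_update_of_lt θ ⟨l, hl⟩ _)]
  simp only [NNReal.coe_inv, NNReal.coe_natCast] at this
  refine this.mono this.1 (fun _ => le_rfl) ?_
  exact mul_le_mul_of_nonneg_left (sum_postKer_sq_le l) hc

lemma MeanLE.preSq_succ {l : ℕ} (hl : l < L) {C K : ℝ}
    (h : MeanLE (initMeasure L w) (fun θ => preSq w (extParams θ) x x' l) C)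
    (hK : MeanLE (initMeasure L w) (fun θ => actKer w (extParams θ) l x x' ^ 2) K) :
    MeanLE (initMeasure L w) (fun θ => preSq w (extParams θ) x x' (l + 1))
      (w (l + 1) * (w (l + 1) * (3 * (quadConst * ((w l : ℝ)⁻¹) ^ 2 * C))) +
        3 * w (l + 1) * (K + ((w l : ℝ)⁻¹) ^ 2 * (w l * C))) := by
  have h1 : MeanLE (initMeasure L w) (fun θ => ∑ a, ∑ b, 3 * kerFluct w (extParams θ) x x' l a b ^ 2)
      (w (l + 1) * (w (l + 1) * (3 * (quadConst * ((w l : ℝ)⁻¹) ^ 2 * C)))) := by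
    have := MeanLE.sum_univ fun a => MeanLE.sum_univ fun b =>
      ((h.kerFluct_sq hl a b).const_mul (c := 3) (by norm_num))
    simpa only [Fintype.card_fin] using this
  have h2 := (hK.add ((h.const_mul (Nat.cast_nonneg (w l))).const_mul
    (sq_nonneg ((w l : ℝ)⁻¹)))).const_mul (c := 3 * (w (l + 1) : ℝ)) (by positivity)
  refine (h1.add h2).mono (by fun_prop) (fun θ => ?_) le_rfl
  have h3 := postTrace_sq_le (θ := extParams θ) (x := x) (x' := x') l
  set T := postTrace w (extParams θ) x x' l
  set A := actKer w (extParams θ) l x x'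
  set v := (w l : ℝ)⁻¹
  have h4 : ∀ a b, preKer w (extParams θ) x x' (l + 1) a b ^ 2 ≤
      3 * kerFluct w (extParams θ) x x' l a b ^ 2 +
        if a = b then 3 * (A ^ 2 + v ^ 2 * T ^ 2) else 0 := by
    intro a b
    rw [preKer_succ_eq]
    set E := kerFluct w (extParams θ) x x' l a b
    split_ifs
    · nlinarith [sq_nonneg (A - v * T), sq_nonneg (A - E), sq_nonneg (v * T - E)]
    · nlinarith [sq_nonneg E]
  calc preSq w (extParams θ) x x' (l + 1)
      ≤ ∑ a, ∑ b, (3 * kerFluct w (extParams θ) x x' l a b ^ 2 +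
        if a = b then 3 * (A ^ 2 + v ^ 2 * T ^ 2) else 0) :=
        Finset.sum_le_sum fun a _ => Finset.sum_le_sum fun b _ => h4 a b
    _ = (∑ a, ∑ b, 3 * kerFluct w (extParams θ) x x' l a b ^ 2) +
        3 * w (l + 1) * (A ^ 2 + v ^ 2 * T ^ 2) := by
        simp only [Finset.sum_add_distrib, Finset.sum_ite_eq, Finset.mem_univ, if_true,
          Finset.sum_const, Finset.card_univ, Fintype.card_fin, nsmul_eq_mul]
        ring
    _ ≤ _ := by gcongr

/-- The negative part of the trace of the tangent kernel stays small: only its fluctuations and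
the negative part of the activation kernel contribute to it. -/
lemma MeanLE.negTrace_succ {l : ℕ} (hl : l < L) {C K N : ℝ}
    (h : MeanLE (initMeasure L w) (fun θ => preSq w (extParams θ) x x' l) C)
    (hK : MeanLE (initMeasure L w) (fun θ => max 0 (-actKer w (extParams θ) l x x') ^ 2) K)
    (hN : MeanLE (initMeasure L w) (fun θ => max 0 (-postTrace w (extParams θ) x x' l) ^ 2) N) :
    MeanLE (initMeasure L w) (fun θ => max 0 (-postTrace w (extParams θ) x x' (l + 1)) ^ 2)
      (3 * (w (l + 1) : ℝ) ^ 2 * (K + ((w l : ℝ)⁻¹) ^ 2 * N) +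
        3 * w (l + 1) * (w (l + 1) * (quadConst * ((w l : ℝ)⁻¹) ^ 2 * C))) := by
  have h1 := (MeanLE.sum_univ fun a => h.kerFluct_sq hl a a).const_mul
    (c := 3 * (w (l + 1) : ℝ)) (by positivity)
  have h2 := (hK.add (hN.const_mul (sq_nonneg ((w l : ℝ)⁻¹)))).const_mul
    (c := 3 * (w (l + 1) : ℝ) ^ 2) (by positivity)
  rw [Fintype.card_fin] at h1
  refine (h2.add h1).mono (by fun_prop) (fun θ => ?_) le_rfl
  set T := postTrace w (extParams θ) x x' l
  set A := actKer w (extParams θ) l x x'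
  set v := (w l : ℝ)⁻¹
  have hv : 0 ≤ v := by positivity
  set m := (w (l + 1) : ℝ)
  set E := kerFluct w (extParams θ) x x' l
  set P := max 0 (-A)
  set Q := max 0 (-T)
  have hP : 0 ≤ P := le_max_left _ _
  have hQ : 0 ≤ Q := le_max_left _ _
  have hb : max 0 (-postTrace w (extParams θ) x x' (l + 1)) ≤ ∑ a, (P + v * Q + |E a a|) := by
    refine max_le (Finset.sum_nonneg fun a _ => by positivity) ?_
    rw [postTrace, ← Finset.sum_neg_distrib]
    refine Finset.sum_le_sum fun a _ => ?_
    rw [postKer, preKer_succ_eq, if_pos rfl]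
    set g := gate (netOut w (extParams θ) (l + 1) x a)
    set g' := gate (netOut w (extParams θ) (l + 1) x' a)
    have hg : 0 ≤ g * g' := mul_nonneg (gate_nonneg _) (gate_nonneg _)
    have hg1 : g * g' ≤ 1 := mul_le_one₀ (gate_le_one _) (gate_nonneg _) (gate_le_one _)
    have hs : -(A + v * T + E a a) ≤ P + v * Q + |E a a| := by
      have h1 : -A ≤ P := le_max_right _ _
      have h2 : v * -T ≤ v * Q := mul_le_mul_of_nonneg_left (le_max_right _ _) hv
      have h3 := neg_abs_le (E a a)
      linarith
    have hs0 : 0 ≤ P + v * Q + |E a a| := by positivity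
    calc -(g * (A + v * T + E a a) * g') = (g * g') * -(A + v * T + E a a) := by ring
      _ ≤ (g * g') * (P + v * Q + |E a a|) := mul_le_mul_of_nonneg_left hs hg
      _ ≤ 1 * (P + v * Q + |E a a|) := mul_le_mul_of_nonneg_right hg1 hs0
      _ = _ := one_mul _
  have h0 : 0 ≤ max 0 (-postTrace w (extParams θ) x x' (l + 1)) := le_max_left _ _
  have h3 := sq_sum_le_card_mul_sum_sq (s := Finset.univ) (f := fun a => P + v * Q + |E a a|)
  rw [Finset.card_univ, Fintype.card_fin] at h3
  have h4 : ∀ a, (P + v * Q + |E a a|) ^ 2 ≤ 3 * (P ^ 2 + v ^ 2 * Q ^ 2) + 3 * E a a ^ 2 := by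
    intro a
    rw [← sq_abs (E a a)]
    nlinarith [sq_nonneg (P - v * Q), sq_nonneg (P - |E a a|), sq_nonneg (v * Q - |E a a|)]
  calc max 0 (-postTrace w (extParams θ) x x' (l + 1)) ^ 2
      ≤ (∑ a, (P + v * Q + |E a a|)) ^ 2 := pow_le_pow_left₀ h0 hb 2
    _ ≤ m * ∑ a, (P + v * Q + |E a a|) ^ 2 := h3
    _ ≤ m * ∑ a, (3 * (P ^ 2 + v ^ 2 * Q ^ 2) + 3 * E a a ^ 2) := by
        gcongr with a
        exact h4 a
    _ = _ := by
        rw [Finset.sum_add_distrib, Finset.sum_const, Finset.card_univ, Fintype.card_fin,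
          nsmul_eq_mul, ← Finset.mul_sum]
        ring

lemma meanLE_preSq_zero :
    MeanLE (initMeasure L w) (fun θ => preSq w (extParams θ) x x' 0) 0 :=
  (MeanLE.const le_rfl).mono (by fun_prop) (fun θ => by simp [preSq]) le_rfl

lemma meanLE_negTrace_zero :
    MeanLE (initMeasure L w) (fun θ => max 0 (-postTrace w (extParams θ) x x' 0) ^ 2) 0 :=
  (MeanLE.const le_rfl).mono (by fun_prop) (fun θ => by simp [postTrace]) le_rfl

lemma meanLE_negAct {l : ℕ} (hl : 0 < l) :
    MeanLE (initMeasure L w) (fun θ => max 0 (-actKer w (extParams θ) l x x') ^ 2) 0 := by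
  obtain ⟨k, rfl⟩ : ∃ k, l = k + 1 := ⟨l - 1, by lia⟩
  refine (MeanLE.const le_rfl).mono (by fun_prop) (fun θ => ?_) le_rfl
  rw [max_eq_left (neg_nonpos.2 (actKer_succ_nonneg k))]
  simp

end LayerBounds

section WidthBounds

variable {D n O L : ℕ}

lemma widths_zero : widths D n O L 0 = D := rfl

lemma widths_hidden {l : ℕ} (h0 : 0 < l) (hl : l < L) : widths D n O L l = n := by
  obtain ⟨l, rfl⟩ := Nat.exists_eq_succ_of_ne_zero h0.ne'
  simp [widths, hl]

lemma widths_last (hL : 0 < L) : widths D n O L L = O := by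
  obtain ⟨l, rfl⟩ := Nat.exists_eq_succ_of_ne_zero hL.ne'
  simp [widths]

lemma widths_ne_zero (hD : 0 < D) (hn : 0 < n) {l : ℕ} (hl : l < L) : widths D n O L l ≠ 0 := by
  rcases Nat.eq_zero_or_pos l with rfl | h0
  · rw [widths_zero]; lia
  · rw [widths_hidden h0 hl]; lia

variable (O)

lemma exists_meanLE_actSq (hD : 0 < D) (x : Fin D → ℝ) (l : ℕ) (hl : l < L) :
    ∃ C : ℝ, 0 ≤ C ∧ ∀ n, 0 < n → MeanLE (initMeasure L (widths D n O L))
      (fun θ => actSq (widths D n O L) (extParams θ) l x ^ 2)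
      (C * (widths D n O L l : ℝ) ^ 2) := by
  induction l with
  | zero =>
    refine ⟨(∑ j, x j ^ 2) ^ 2, sq_nonneg _, fun n hn => ?_⟩
    refine (MeanLE.const (C := (∑ j, x j ^ 2) ^ 2) (sq_nonneg _)).mono (by fun_prop)
      (fun θ => le_rfl) ?_
    have : (1 : ℝ) ≤ D := by exact_mod_cast hD
    exact le_mul_of_one_le_right (sq_nonneg _) (one_le_pow₀ this)
  | succ l ih =>
    obtain ⟨C, hC, h⟩ := ih (by lia)
    refine ⟨linConst * C, mul_nonneg linConst_pos.le hC, fun n hn => ?_⟩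
    have h1 := (h n hn).actSq_succ (by lia)
    have hne : (widths D n O L l : ℝ) ≠ 0 := by
      exact_mod_cast widths_ne_zero hD hn (by lia)
    refine h1.mono h1.1 (fun _ => le_rfl) (le_of_eq ?_)
    field_simp

lemma exists_meanLE_actKer (hD : 0 < D) (x x' : Fin D → ℝ) (l : ℕ) (hl : l < L) :
    ∃ K : ℝ, 0 ≤ K ∧ ∀ n, 0 < n → MeanLE (initMeasure L (widths D n O L))
      (fun θ => actKer (widths D n O L) (extParams θ) l x x' ^ 2)
      (K * (widths D n O L l : ℝ) ^ 2) := by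
  obtain ⟨C, hC, h⟩ := exists_meanLE_actSq O hD x l hl
  obtain ⟨C', hC', h'⟩ := exists_meanLE_actSq O hD x' l hl
  refine ⟨C + C', by positivity, fun n hn => ?_⟩
  exact ((h n hn).add (h' n hn)).mono (by fun_prop) (fun θ => actKer_sq_le l) (by rw [add_mul])

lemma exists_meanLE_preSq (hD : 0 < D) (x x' : Fin D → ℝ) (l : ℕ) (hl : l < L) :
    ∃ B : ℝ, 0 ≤ B ∧ ∀ n, 0 < n → MeanLE (initMeasure L (widths D n O L))
      (fun θ => preSq (widths D n O L) (extParams θ) x x' l) (B * (n : ℝ) ^ 3) := by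
  induction l with
  | zero =>
    refine ⟨0, le_rfl, fun n hn => ?_⟩
    rw [zero_mul]
    exact meanLE_preSq_zero
  | succ l ih =>
    obtain ⟨B, hB, h⟩ := ih (by lia)
    obtain ⟨K, hK, hk⟩ := exists_meanLE_actKer O hD x x' l (by lia : l < L)
    have hq := quadConst_pos
    rcases Nat.eq_zero_or_pos l with rfl | h0
    · refine ⟨3 * K * D ^ 2, by positivity, fun n hn => ?_⟩
      have h1 := meanLE_preSq_zero.preSq_succ (by lia) (hk n hn)
      refine h1.mono h1.1 (fun _ => le_rfl) ?_
      rw [widths_hidden (by lia) hl, widths_zero]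
      have hn1 : (1 : ℝ) ≤ n := by exact_mod_cast hn
      have : (n : ℝ) ≤ (n : ℝ) ^ 3 := le_self_pow₀ hn1 (by norm_num)
      calc _ = 3 * K * D ^ 2 * (n : ℝ) := by ring
        _ ≤ _ := by gcongr
    · refine ⟨3 * quadConst * B + 3 * K + 3 * B, by positivity, fun n hn => ?_⟩
      have h1 := (h n hn).preSq_succ (by lia) (hk n hn)
      refine h1.mono h1.1 (fun _ => le_rfl) (le_of_eq ?_)
      rw [widths_hidden (by lia) hl, widths_hidden h0 (by lia)]
      have : (n : ℝ) ≠ 0 := by positivity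
      field_simp
      ring

lemma exists_meanLE_negTrace (hD : 0 < D) (x x' : Fin D → ℝ) (l : ℕ) (hl : l < L) :
    ∃ B : ℝ, 0 ≤ B ∧ ∀ n, 0 < n → MeanLE (initMeasure L (widths D n O L))
      (fun θ => max 0 (-postTrace (widths D n O L) (extParams θ) x x' l) ^ 2)
      (B * (n : ℝ) ^ 3) := by
  induction l with
  | zero =>
    refine ⟨0, le_rfl, fun n hn => ?_⟩
    rw [zero_mul]
    exact meanLE_negTrace_zero
  | succ l ih =>
    obtain ⟨B, hB, h⟩ := ih (by lia)
    obtain ⟨C, hC, hpre⟩ := exists_meanLE_preSq O hD x x' l (by lia : l < L)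
    have hq := quadConst_pos
    rcases Nat.eq_zero_or_pos l with rfl | h0
    · obtain ⟨K, hK, hk⟩ := exists_meanLE_actKer O hD x x' 0 (by lia : 0 < L)
      refine ⟨3 * (K * D ^ 2), by positivity, fun n hn => ?_⟩
      have hk' : MeanLE (initMeasure L (widths D n O L))
          (fun θ => max 0 (-actKer (widths D n O L) (extParams θ) 0 x x') ^ 2)
          (K * (widths D n O L 0 : ℝ) ^ 2) := by
        refine (hk n hn).mono (by fun_prop) (fun θ => ?_) le_rfl
        refine sq_le_sq.2 ?_
        rw [abs_of_nonneg (le_max_left _ _)]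
        exact max_le (abs_nonneg _) (neg_le_abs _)
      have h1 := meanLE_preSq_zero.negTrace_succ (by lia) hk' meanLE_negTrace_zero
      refine h1.mono h1.1 (fun _ => le_rfl) ?_
      rw [widths_hidden (by lia) hl, widths_zero]
      have hn1 : (1 : ℝ) ≤ n := by exact_mod_cast hn
      have : (n : ℝ) ^ 2 ≤ (n : ℝ) ^ 3 := pow_le_pow_right₀ hn1 (by norm_num)
      calc _ = 3 * (K * D ^ 2) * (n : ℝ) ^ 2 := by ring
        _ ≤ _ := by gcongr
    · refine ⟨3 * B + 3 * quadConst * C, by positivity, fun n hn => ?_⟩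
      have h1 := (hpre n hn).negTrace_succ (by lia) (meanLE_negAct h0) (h n hn)
      refine h1.mono h1.1 (fun _ => le_rfl) (le_of_eq ?_)
      rw [widths_hidden (by lia) hl, widths_hidden h0 (by lia)]
      have : (n : ℝ) ≠ 0 := by positivity
      field_simp
      ring

end WidthBounds

section LowerBounds

lemma measurable_reluCov {κ : Type*} [Fintype κ] (v : NNReal) :
    Measurable fun p : (κ → ℝ) × (κ → ℝ) => reluCov v p.1 p.2 := by
  unfold reluCov
  have hc : Continuous fun q : ((κ → ℝ) × (κ → ℝ)) × (κ → ℝ) =>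
      relu (∑ j, q.2 j * q.1.1 j) * relu (∑ j, q.2 j * q.1.2 j) :=
    (continuous_relu.comp (by fun_prop)).mul (continuous_relu.comp (by fun_prop))
  exact hc.stronglyMeasurable.integral_prod_right'.measurable

variable {L : ℕ} {w : ℕ → ℕ}

variable (w) in
/-- The ReLU covariance of two neurons in layer `l + 1`, given the activations of layer `l`. -/
def layerCov (θ : (l : ℕ) → Fin (w (l + 1)) → Fin (w l) → ℝ) (x x' : Fin (w 0) → ℝ) (l : ℕ) : ℝ :=
  reluCov ((w l : NNReal))⁻¹ (layerOut w θ l x) (layerOut w θ l x')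

variable {x x' : Fin (w 0) → ℝ}

@[fun_prop]
lemma measurable_layerCov (l : ℕ) :
    Measurable fun θ : Params L w => layerCov w (extParams θ) x x' l :=
  (measurable_reluCov _).comp (Measurable.prodMk
    (measurable_pi_lambda _ fun j => measurable_layerOut l x j)
    (measurable_pi_lambda _ fun j => measurable_layerOut l x' j))

lemma MeanLE.actKer_sub_sq {l : ℕ} (hl : l < L) {C C' : ℝ}
    (h : MeanLE (initMeasure L w) (fun θ => actSq w (extParams θ) l x ^ 2) C)
    (h' : MeanLE (initMeasure L w) (fun θ => actSq w (extParams θ) l x' ^ 2) C') :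
    MeanLE (initMeasure L w) (fun θ => (actKer w (extParams θ) (l + 1) x x' -
      w (l + 1) * layerCov w (extParams θ) x x' l) ^ 2)
      (w (l + 1) * (linConst * ((w l : ℝ)⁻¹) ^ 2) * (C + C')) := by
  have hc : 0 ≤ (w (l + 1) : ℝ) * (linConst * ((w l : ℝ)⁻¹) ^ 2) := by
    have := linConst_pos
    positivity
  refine MeanLE.of_layer hl (by fun_prop) ((h.add h').const_mul hc) fun θ => ?_
  have := meanLE_sum_relu_sub_sq (ι := Fin (w (l + 1))) ((w l : NNReal))⁻¹
    (layerOut w (extParams θ) l x) (layerOut w (extParams θ) l x')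
  simp only [actKer, actSq, layerCov, layerOut_succ, extParams_update_mk,
    layerOut_congr l (extParams_update_of_lt θ ⟨l, hl⟩ _)]
  simp only [Fintype.card_fin, NNReal.coe_inv, NNReal.coe_natCast] at this
  simpa only [mul_assoc] using this

lemma layerCov_of_actKer_eq_zero {θ : (l : ℕ) → Fin (w (l + 1)) → Fin (w l) → ℝ} {l : ℕ}
    (h : actKer w θ l x x' = 0) : layerCov w θ x x' l =
      (√((w l : ℝ)⁻¹ * actKer w θ l x x) * reluMean) *
        (√((w l : ℝ)⁻¹ * actKer w θ l x' x') * reluMean) := by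
  rw [actKer_self, actKer_self, actSq, actSq, layerCov, reluCov_of_orthogonal _ _ _ h]
  simp

lemma half_actKer_le_layerCov {θ : (l : ℕ) → Fin (w (l + 1)) → Fin (w l) → ℝ} {l : ℕ} :
    ((w l : ℝ)⁻¹ / 2) * actKer w θ l x x' ≤ layerCov w θ x x' l := by
  have := half_inner_le_reluCov ((w l : NNReal))⁻¹ (layerOut w θ l x) (layerOut w θ l x')
  simpa only [NNReal.coe_inv, NNReal.coe_natCast, actKer, layerCov] using this

lemma netOut_one_opposite {θ : (l : ℕ) → Fin (w (l + 1)) → Fin (w l) → ℝ} {c : ℝ}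
    (j : Fin (w 1)) : netOut w θ 1 (-c • x) j = -(c * netOut w θ 1 x j) := by
  change ∑ i, θ 0 j i * (-c • x) i = -(c * ∑ i, θ 0 j i * x i)
  rw [Finset.mul_sum, ← Finset.sum_neg_distrib]
  refine Finset.sum_congr rfl fun i _ => ?_
  simp only [Pi.smul_apply, smul_eq_mul]
  ring

lemma actKer_one_opposite {θ : (l : ℕ) → Fin (w (l + 1)) → Fin (w l) → ℝ} {c : ℝ}
    (hc : 0 < c) : actKer w θ 1 x (-c • x) = 0 := by
  refine Finset.sum_eq_zero fun j _ => ?_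
  change relu (netOut w θ 1 x j) * relu (netOut w θ 1 (-c • x) j) = 0
  rw [netOut_one_opposite]
  rcases le_total (netOut w θ 1 x j) 0 with h | h
  · simp [relu, h]
  · have : 0 ≤ c * netOut w θ 1 x j := by positivity
    simp [relu, this]

variable {D O : ℕ}

/-- Bounded away from zero in probability as the width grows. -/
def BoundedBelow (X : ∀ n, Params L (widths D n O L) → ℝ) : Prop :=
  ∀ ε : ℝ, 0 < ε → ∃ c : ℝ, 0 < c ∧ ∃ n₀ : ℕ, ∀ n, n₀ < n →
    initMeasure L (widths D n O L) {θ | X n θ < c} ≤ ENNReal.ofReal ε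

lemma boundedBelow_const {c : ℝ} (hc : 0 < c) :
    BoundedBelow (L := L) (D := D) (O := O) fun _ _ => c :=
  fun ε _ => ⟨c, hc, 0, fun n _ => by simp⟩

lemma BoundedBelow.map₂ {X Y Z : ∀ n, Params L (widths D n O L) → ℝ} (hX : BoundedBelow X)
    (hY : BoundedBelow Y) (h : ∀ a b : ℝ, 0 < a → 0 < b → ∃ c : ℝ, 0 < c ∧ ∀ n, 0 < n →
      ∀ θ, a ≤ X n θ → b ≤ Y n θ → c ≤ Z n θ) : BoundedBelow Z := by
  intro ε hε
  obtain ⟨a, ha, n₁, h1⟩ := hX (ε / 2) (by positivity)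
  obtain ⟨b, hb, n₂, h2⟩ := hY (ε / 2) (by positivity)
  obtain ⟨c, hc, h3⟩ := h a b ha hb
  refine ⟨c, hc, n₁ + n₂, fun n hn => ?_⟩
  have hsub : {θ | Z n θ < c} ⊆ {θ | X n θ < a} ∪ {θ | Y n θ < b} := by
    intro θ hθ
    by_contra hcon
    simp only [Set.mem_union, Set.mem_ofPred_eq, not_or, not_lt] at hcon hθ
    exact absurd (h3 n (by lia) θ hcon.1 hcon.2) (not_le.2 hθ)
  refine (measure_mono hsub).trans ((measure_union_le _ _).trans
    ((add_le_add (h1 n (by lia)) (h2 n (by lia))).trans_eq ?_))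
  rw [← ENNReal.ofReal_add (by positivity) (by positivity), add_halves]

lemma BoundedBelow.map {X Z : ∀ n, Params L (widths D n O L) → ℝ} (hX : BoundedBelow X)
    (h : ∀ a : ℝ, 0 < a → ∃ c : ℝ, 0 < c ∧ ∀ n, 0 < n → ∀ θ, a ≤ X n θ → c ≤ Z n θ) :
    BoundedBelow Z :=
  hX.map₂ hX fun a _ ha _ => (h a ha).imp fun _ hc =>
    ⟨hc.1, fun n hn θ hθ _ => hc.2 n hn θ hθ⟩

lemma BoundedBelow.actKer_succ (hD : 0 < D) {x x' : Fin D → ℝ} {l : ℕ} (hl : l + 1 < L)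
    (h : BoundedBelow (L := L) (D := D) (O := O)
      fun n θ => layerCov (widths D n O L) (extParams θ) x x' l) :
    BoundedBelow (L := L) (D := D) (O := O)
      fun n θ => actKer (widths D n O L) (extParams θ) (l + 1) x x' / n := by
  intro ε hε
  obtain ⟨c, hc, n₁, h1⟩ := h (ε / 2) (by positivity)
  obtain ⟨C, hC, h2⟩ := exists_meanLE_actSq O hD x l (by lia : l < L)
  obtain ⟨C', hC', h3⟩ := exists_meanLE_actSq O hD x' l (by lia : l < L)
  have hlin := linConst_pos
  set B := linConst * (C + C') * 4 / c ^ 2 with hB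
  have hB0 : 0 ≤ B := by positivity
  refine ⟨c / 2, by positivity, n₁ + ⌈B / (ε / 2)⌉₊, fun n hn => ?_⟩
  have hn0 : 0 < n := by lia
  have hnR : (0 : ℝ) < n := by exact_mod_cast hn0
  have hBn : B / n ≤ ε / 2 := by
    have h4 : B / (ε / 2) ≤ n :=
      (Nat.le_ceil _).trans (by exact_mod_cast (by lia : ⌈B / (ε / 2)⌉₊ ≤ n))
    rw [div_le_iff₀ (by positivity)] at h4 ⊢
    linarith
  have h5 := ((h2 n hn0).actKer_sub_sq (by lia) (h3 n hn0)).measure_le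
    (t := (c / 2 * n) ^ 2) (by positivity)
  have hwne : (widths D n O L l : ℝ) ≠ 0 := by
    exact_mod_cast widths_ne_zero hD hn0 (by lia : l < L)
  have hw : (widths D n O L (l + 1) : ℝ) = n := by rw [widths_hidden (by lia) hl]
  have h6 : (widths D n O L (l + 1) : ℝ) * (linConst * ((widths D n O L l : ℝ)⁻¹) ^ 2) *
      (C * (widths D n O L l : ℝ) ^ 2 + C' * (widths D n O L l : ℝ) ^ 2) / (c / 2 * n) ^ 2 =
      B / n := by
    rw [hw, hB]
    field_simp
    ring
  rw [h6, hw] at h5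
  have hsub : {θ : Params L (widths D n O L) |
      actKer (widths D n O L) (extParams θ) (l + 1) x x' / n < c / 2} ⊆
      {θ | layerCov (widths D n O L) (extParams θ) x x' l < c} ∪
      {θ | (c / 2 * n) ^ 2 ≤ (actKer (widths D n O L) (extParams θ) (l + 1) x x' -
        n * layerCov (widths D n O L) (extParams θ) x x' l) ^ 2} := by
    intro θ hθ
    rw [Set.mem_ofPred_eq, div_lt_iff₀ hnR] at hθ
    by_contra hcon
    simp only [Set.mem_union, Set.mem_ofPred_eq, not_or, not_lt, not_le] at hcon
    have h7 := mul_le_mul_of_nonneg_left hcon.1 hnR.le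
    exact absurd (pow_le_pow_left₀ (by positivity) (by linarith : c / 2 * n ≤
      -(actKer (widths D n O L) (extParams θ) (l + 1) x x' -
        n * layerCov (widths D n O L) (extParams θ) x x' l)) 2)
      (by rw [neg_sq]; exact not_le.2 hcon.2)
  refine (measure_mono hsub).trans ((measure_union_le _ _).trans
    ((add_le_add (h1 n (by lia)) (h5.trans (ENNReal.ofReal_le_ofReal hBn))).trans_eq ?_))
  rw [← ENNReal.ofReal_add (by positivity) (by positivity), add_halves]

lemma BoundedBelow.layerCov {x x' : Fin D → ℝ} {l : ℕ} (h0 : 0 < l) (hl : l < L)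
    (h : BoundedBelow (L := L) (D := D) (O := O)
      fun n θ => actKer (widths D n O L) (extParams θ) l x x' / n) :
    BoundedBelow (L := L) (D := D) (O := O)
      fun n θ => layerCov (widths D n O L) (extParams θ) x x' l := by
  refine h.map fun a ha => ⟨a / 2, by positivity, fun n hn θ hθ => ?_⟩
  refine le_trans ?_ half_actKer_le_layerCov
  have hw : (widths D n O L l : ℝ) = n := by rw [widths_hidden h0 hl]
  rw [hw]
  calc a / 2 ≤ actKer (widths D n O L) (extParams θ) l x x' / n / 2 := by gcongr
    _ = _ := by ring

lemma BoundedBelow.actKer_of_le (hD : 0 < D) {x x' : Fin D → ℝ} {l k : ℕ} (h0 : 0 < l)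
    (hlk : l ≤ k) (hk : k < L)
    (h : BoundedBelow (L := L) (D := D) (O := O)
      fun n θ => actKer (widths D n O L) (extParams θ) l x x' / n) :
    BoundedBelow (L := L) (D := D) (O := O)
      fun n θ => actKer (widths D n O L) (extParams θ) k x x' / n := by
  induction k, hlk using Nat.le_induction with
  | base => exact h
  | succ k hlk ih => exact ((ih (by lia)).layerCov (by lia) (by lia)).actKer_succ hD hk

lemma boundedBelow_actKer_one (hD : 0 < D) (hL : 1 < L) {x x' : Fin D → ℝ}
    (h : ∃ w : Fin D → ℝ, 0 < ∑ j, w j * x j ∧ 0 < ∑ j, w j * x' j) :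
    BoundedBelow (L := L) (D := D) (O := O)
      fun n θ => actKer (widths D n O L) (extParams θ) 1 x x' / n := by
  have hv : ((D : NNReal))⁻¹ ≠ 0 := by
    simpa using hD.ne'
  exact (boundedBelow_const (reluCov_pos hv x x' h)).actKer_succ hD hL

/-- For inputs pointing in opposite directions, the activation kernel degenerates in the first
layer but not from the second one on. -/
lemma boundedBelow_actKer_two (hD : 0 < D) (hL : 2 < L) {x : Fin D → ℝ} (hx : x ≠ 0) {c : ℝ}
    (hc : 0 < c) :
    BoundedBelow (L := L) (D := D) (O := O)
      fun n θ => actKer (widths D n O L) (extParams θ) 2 x (-c • x) / n := by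
  have hpos : 0 < ∑ j, x j * x j := by
    obtain ⟨j, hj⟩ := Function.ne_iff.1 hx
    have hj' : x j ≠ 0 := hj
    exact Finset.sum_pos' (fun _ _ => mul_self_nonneg _) ⟨j, Finset.mem_univ j, mul_self_pos.2 hj'⟩
  have h1 : BoundedBelow (L := L) (D := D) (O := O)
      fun n θ => actKer (widths D n O L) (extParams θ) 1 x x / n :=
    boundedBelow_actKer_one hD (by lia) ⟨x, hpos, hpos⟩
  have h2 : BoundedBelow (L := L) (D := D) (O := O)
      fun n θ => actKer (widths D n O L) (extParams θ) 1 (-c • x) (-c • x) / n := by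
    have : 0 < ∑ j, (-x) j * (-c • x) j := by
      have h3 : ∑ j, (-x) j * (-c • x) j = c * ∑ j, x j * x j := by
        rw [Finset.mul_sum]
        refine Finset.sum_congr rfl fun j _ => ?_
        simp only [Pi.neg_apply, Pi.smul_apply, smul_eq_mul]
        ring
      rw [h3]
      positivity
    exact boundedBelow_actKer_one hD (by lia) ⟨-x, this, this⟩
  refine BoundedBelow.actKer_succ (l := 1) hD hL (h1.map₂ h2 fun a b ha hb =>
    ⟨(√a * reluMean) * (√b * reluMean), ?_, fun n hn θ hθa hθb => ?_⟩)
  · have := reluMean_pos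
    positivity
  have hm := reluMean_pos
  have hw : (widths D n O L 1 : ℝ) = n := by rw [widths_hidden (by lia) (by lia)]
  refine le_of_le_of_eq ?_ (layerCov_of_actKer_eq_zero (actKer_one_opposite hc)).symm
  rw [hw]
  gcongr
  · exact hθa.trans_eq (div_eq_inv_mul _ _)
  · exact hθb.trans_eq (div_eq_inv_mul _ _)

end LowerBounds

section DegenerateInputs

variable {w : ℕ → ℕ} {θ : (l : ℕ) → Fin (w (l + 1)) → Fin (w l) → ℝ} {x x' : Fin (w 0) → ℝ}

lemma layerOut_zero_input (l : ℕ) : layerOut w θ l 0 = 0 := by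
  induction l with
  | zero => rfl
  | succ l ih =>
    ext i
    simp [layerOut_succ, ih, relu]

lemma netOut_zero_input (l : ℕ) : netOut w θ l 0 = 0 := by
  cases l with
  | zero => rfl
  | succ l =>
    ext i
    simp [netOut_succ, layerOut_zero_input]

lemma preKer_of_eq_zero (h : x = 0 ∨ x' = 0) (l : ℕ) : preKer w θ x x' l = 0 := by
  cases l with
  | zero => rfl
  | succ l =>
    ext a b
    rcases h with rfl | rfl <;>
      simp [preKer_succ, postKer, actKer, layerOut_zero_input, netOut_zero_input, gate]

lemma preKer_two_opposite {c : ℝ} (hc : 0 < c) : preKer w θ x (-c • x) 2 = 0 := by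
  have hpost (i j : Fin (w 1)) : postKer w θ x (-c • x) 1 i j = 0 := by
    have h1 : preKer w θ x (-c • x) 1 i j = if i = j then actKer w θ 0 x (-c • x) else 0 := by
      rw [preKer_succ 0]
      simp
    rw [postKer, h1, netOut_one_opposite]
    split_ifs with h
    · subst h
      rcases le_total (netOut w θ 1 x i) 0 with h | h
      · simp [gate, h.not_gt]
      · have : ¬ c * netOut w θ 1 x i < 0 := not_lt.2 (by positivity)
        simp [gate, this]
    · simp
  ext a b
  rw [preKer_succ 1, actKer_one_opposite hc]
  simp only [hpost]
  simp

/-- Two vectors either have a common direction of increase, or one of them vanishes, or they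
point in opposite directions. -/
lemma common_direction_or {κ : Type*} [Fintype κ] (x x' : κ → ℝ) :
    (x = 0 ∨ x' = 0) ∨ (∃ w : κ → ℝ, 0 < ∑ j, w j * x j ∧ 0 < ∑ j, w j * x' j) ∨
      ∃ c : ℝ, 0 < c ∧ x' = -c • x := by
  have hpos (z : κ → ℝ) (hz : z ≠ 0) : 0 < ∑ j, z j * z j := by
    obtain ⟨j, hj⟩ := Function.ne_iff.1 hz
    have hj' : z j ≠ 0 := hj
    exact Finset.sum_pos' (fun _ _ => mul_self_nonneg _)
      ⟨j, Finset.mem_univ j, mul_self_pos.2 hj'⟩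
  by_cases h0 : x = 0 ∨ x' = 0
  · exact Or.inl h0
  right
  push Not at h0
  have ha := hpos x h0.1
  have hb := hpos x' h0.2
  set a := √(∑ j, x j * x j) with ha'
  set b := √(∑ j, x' j * x' j) with hb'
  have ha2 : a ^ 2 = ∑ j, x j * x j := Real.sq_sqrt ha.le
  have hb2 : b ^ 2 = ∑ j, x' j * x' j := Real.sq_sqrt hb.le
  have ha0 : 0 < a := Real.sqrt_pos.2 ha
  have hb0 : 0 < b := Real.sqrt_pos.2 hb
  set p := ∑ j, x j * x' j with hp
  have e1 : ∑ j, (b • x + a • x') j * x j = b * a ^ 2 + a * p := by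
    rw [ha2, hp, Finset.mul_sum, Finset.mul_sum, ← Finset.sum_add_distrib]
    refine Finset.sum_congr rfl fun j _ => ?_
    simp only [Pi.add_apply, Pi.smul_apply, smul_eq_mul]
    ring
  have e2 : ∑ j, (b • x + a • x') j * x' j = b * p + a * b ^ 2 := by
    rw [hb2, hp, Finset.mul_sum, Finset.mul_sum, ← Finset.sum_add_distrib]
    refine Finset.sum_congr rfl fun j _ => ?_
    simp only [Pi.add_apply, Pi.smul_apply, smul_eq_mul]
    ring
  by_cases hz : b • x + a • x' = 0
  · right
    refine ⟨b / a, by positivity, ?_⟩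
    ext j
    have := congrFun hz j
    simp only [Pi.add_apply, Pi.smul_apply, smul_eq_mul, Pi.zero_apply] at this ⊢
    field_simp
    linarith
  · left
    have h1 := hpos _ hz
    have e3 : ∑ j, (b • x + a • x') j * (b • x + a • x') j =
        b * (b * a ^ 2 + a * p) + a * (b * p + a * b ^ 2) := by
      rw [← e1, ← e2, Finset.mul_sum, Finset.mul_sum, ← Finset.sum_add_distrib]
      refine Finset.sum_congr rfl fun j _ => ?_
      simp only [Pi.add_apply, Pi.smul_apply, smul_eq_mul]
      ring
    rw [e3] at h1
    have h2 : 0 < a * b * (a * b + p) := by nlinarith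
    have h3 : 0 < a * b + p := pos_of_mul_pos_right h2 (by positivity)
    refine ⟨b • x + a • x', ?_, ?_⟩
    · rw [e1]
      have : 0 < a * (a * b + p) := by positivity
      linarith
    · rw [e2]
      have : 0 < b * (a * b + p) := by positivity
      linarith

end DegenerateInputs

section FrobeniusRatio

variable {ι : Type*} [Fintype ι] [DecidableEq ι] [Nonempty ι]

lemma abs_le_frobNorm (T : Matrix ι ι ℝ) (a b : ι) : |T a b| ≤ frobNorm T := by
  refine Real.abs_le_sqrt ?_
  exact (Finset.single_le_sum (f := fun b => T a b ^ 2) (fun _ _ => sq_nonneg _)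
    (Finset.mem_univ b)).trans (Finset.single_le_sum (f := fun a => ∑ b, T a b ^ 2)
      (fun _ _ => Finset.sum_nonneg fun _ _ => sq_nonneg _) (Finset.mem_univ a))

/-- A matrix close to a multiple of the identity is relatively close to its average entry
times the identity. -/
lemma frobNorm_sub_smul_one_div_le {T : Matrix ι ι ℝ} {s p F d : ℝ} {E : ι → ι → ℝ}
    (hT : ∀ a b, T a b = (if a = b then s else 0) + E a b)
    (hp : p = (Fintype.card ι : ℝ)⁻¹ * ∑ a, ∑ b, T a b)
    (hF : 0 ≤ F) (hE : ∑ a, ∑ b, E a b ^ 2 ≤ F ^ 2) (hd : 0 < d) (hs : d + F ≤ s) :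
    frobNorm (T - p • (1 : Matrix ι ι ℝ)) / frobNorm T ≤
      √(2 + 2 * Fintype.card ι) * F / d := by
  set m : ℝ := (Fintype.card ι : ℝ) with hm
  have hm0 : 0 < m := by rw [hm]; exact_mod_cast Fintype.card_pos
  set e := m⁻¹ * ∑ a, ∑ b, E a b with he
  have hpe : p = s + e := by
    rw [hp, he]
    simp only [hT, Finset.sum_add_distrib, Finset.sum_ite_eq, Finset.mem_univ, if_true,
      Finset.sum_const, Finset.card_univ, nsmul_eq_mul]
    rw [← hm]
    field_simp
  have he2 : e ^ 2 ≤ F ^ 2 := by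
    have h1 : (∑ a, ∑ b, E a b) ^ 2 ≤ m * ∑ a, (∑ b, E a b) ^ 2 := by
      simpa [hm] using sq_sum_le_card_mul_sum_sq (s := Finset.univ) (f := fun a => ∑ b, E a b)
    have h2 : ∀ a, (∑ b, E a b) ^ 2 ≤ m * ∑ b, E a b ^ 2 := fun a => by
      simpa [hm] using sq_sum_le_card_mul_sum_sq (s := Finset.univ) (f := fun b => E a b)
    have h3 : (∑ a, ∑ b, E a b) ^ 2 ≤ m ^ 2 * F ^ 2 :=
      calc _ ≤ m * ∑ a, (∑ b, E a b) ^ 2 := h1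
        _ ≤ m * ∑ a, m * ∑ b, E a b ^ 2 := by
          gcongr with a
          exact h2 a
        _ = m ^ 2 * ∑ a, ∑ b, E a b ^ 2 := by rw [← Finset.mul_sum]; ring
        _ ≤ _ := by gcongr
    rw [he, mul_pow, inv_pow]
    rwa [inv_mul_le_iff₀ (by positivity)]
  have hnum : frobNorm (T - p • (1 : Matrix ι ι ℝ)) ≤ √(2 + 2 * m) * F := by
    rw [frobNorm]
    refine Real.sqrt_le_iff.2 ⟨by positivity, ?_⟩
    rw [mul_pow, Real.sq_sqrt (by positivity)]
    have h1 : ∀ a b, (T - p • (1 : Matrix ι ι ℝ)) a b ^ 2 ≤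
        2 * E a b ^ 2 + if a = b then 2 * e ^ 2 else 0 := by
      intro a b
      simp only [Matrix.sub_apply, Matrix.smul_apply, Matrix.one_apply, hT, hpe, smul_eq_mul]
      split_ifs
      · nlinarith [sq_nonneg (E a b + e)]
      · nlinarith [sq_nonneg (E a b)]
    calc _ ≤ ∑ a, ∑ b, (2 * E a b ^ 2 + if a = b then 2 * e ^ 2 else 0) :=
          Finset.sum_le_sum fun a _ => Finset.sum_le_sum fun b _ => h1 a b
      _ = 2 * ∑ a, ∑ b, E a b ^ 2 + 2 * m * e ^ 2 := by
          simp only [Finset.sum_add_distrib, Finset.sum_ite_eq, Finset.mem_univ, if_true,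
            Finset.sum_const, Finset.card_univ, nsmul_eq_mul, ← Finset.mul_sum]
          ring
      _ ≤ 2 * F ^ 2 + 2 * m * F ^ 2 := by gcongr
      _ = _ := by ring
  have hden : d ≤ frobNorm T := by
    obtain ⟨a⟩ := ‹Nonempty ι›
    refine le_trans ?_ (abs_le_frobNorm T a a)
    have h1 : E a a ^ 2 ≤ F ^ 2 :=
      ((Finset.single_le_sum (f := fun b => E a b ^ 2) (fun _ _ => sq_nonneg _)
        (Finset.mem_univ a)).trans (Finset.single_le_sum (f := fun a => ∑ b, E a b ^ 2)
          (fun _ _ => Finset.sum_nonneg fun _ _ => sq_nonneg _) (Finset.mem_univ a))).trans hE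
    have h2 := (abs_le_of_sq_le_sq' h1 hF).1
    refine le_trans ?_ (le_abs_self _)
    rw [hT, if_pos rfl]
    linarith
  exact div_le_div₀ (by positivity) hnum hd hden

end FrobeniusRatio

section RelativeError

variable {D O : ℕ}

lemma Nondegenerate.frobNorm_ratio_eq_zero {L : ℕ} {w : ℕ → ℕ} {θ : Params L w}
    {x x' : Fin (w 0) → ℝ} (h : Nondegenerate θ x) (h' : Nondegenerate θ x')
    (hz : preKer w (extParams θ) x x' L = 0) (p : ℝ) :
    frobNorm (eNTK L w θ x x' - p • (1 : Matrix (Fin (w L)) (Fin (w L)) ℝ)) /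
      frobNorm (eNTK L w θ x x') = 0 := by
  have : frobNorm (eNTK L w θ x x') = 0 := by
    rw [h.eNTK_eq h', hz]
    simp [frobNorm]
  rw [this, div_zero]

lemma Nondegenerate.frobNorm_ratio_le {M : ℕ} {w : ℕ → ℕ} {θ : Params (M + 1) w}
    {x x' : Fin (w 0) → ℝ} (h : Nondegenerate θ x) (h' : Nondegenerate θ x')
    (hw : w (M + 1) ≠ 0) {F d : ℝ} (hF : 0 ≤ F)
    (hE : ∑ a, ∑ b, kerFluct w (extParams θ) x x' M a b ^ 2 ≤ F ^ 2) (hd : 0 < d)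
    (hs : d + F ≤ actKer w (extParams θ) M x x' +
      (w M : ℝ)⁻¹ * postTrace w (extParams θ) x x' M) :
    frobNorm (eNTK (M + 1) w θ x x' - pNTK (M + 1) w θ x x' •
        (1 : Matrix (Fin (w (M + 1))) (Fin (w (M + 1))) ℝ)) /
      frobNorm (eNTK (M + 1) w θ x x') ≤ √(2 + 2 * (w (M + 1) : ℝ)) * F / d := by
  have : Nonempty (Fin (w (M + 1))) := Fin.pos_iff_nonempty.1 (Nat.pos_of_ne_zero hw)
  rw [h.pNTK_eq h', h.eNTK_eq h']
  have := frobNorm_sub_smul_one_div_le (T := preKer w (extParams θ) x x' (M + 1))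
    (fun a b => preKer_succ_eq M a b) rfl hF hE hd hs
  simpa only [Fintype.card_fin] using this

lemma ofReal_one_sub_le_measure {Ω : Type*} [MeasurableSpace Ω] {μ : Measure Ω}
    [IsProbabilityMeasure μ] {s t : Set Ω} {δ : ℝ} (hδ : 0 ≤ δ) (h : ∀ ω, ω ∉ t → ω ∈ s)
    (ht : μ t ≤ ENNReal.ofReal δ) : ENNReal.ofReal (1 - δ) ≤ μ s := by
  rw [ENNReal.ofReal_sub _ hδ, ENNReal.ofReal_one, tsub_le_iff_right]
  calc 1 = μ Set.univ := measure_univ.symm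
    _ ≤ μ (s ∪ t) := measure_mono fun ω _ => by
        by_cases hω : ω ∈ t
        · exact Or.inr hω
        · exact Or.inl (h ω hω)
    _ ≤ μ s + μ t := measure_union_le _ _
    _ ≤ _ := by gcongr

lemma exists_meanLE_sum_kerFluct_sq (hD : 0 < D) (x x' : Fin D → ℝ) {M : ℕ} (hM : 0 < M) :
    ∃ B : ℝ, 0 ≤ B ∧ ∀ n, 0 < n → MeanLE (initMeasure (M + 1) (widths D n O (M + 1)))
      (fun θ => ∑ a, ∑ b, kerFluct (widths D n O (M + 1)) (extParams θ) x x' M a b ^ 2)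
      (B * n) := by
  obtain ⟨C, hC, h⟩ := exists_meanLE_preSq O hD x x' M (by lia : M < M + 1)
  have hq := quadConst_pos
  refine ⟨O * (O * (quadConst * C)), by positivity, fun n hn => ?_⟩
  have h1 := MeanLE.sum_univ fun a => MeanLE.sum_univ fun b =>
    (h n hn).kerFluct_sq (by lia : M < M + 1) a b
  refine h1.mono h1.1 (fun _ => le_rfl) (le_of_eq ?_)
  rw [Fintype.card_fin, widths_last (by lia), widths_hidden hM (by lia)]
  have : (n : ℝ) ≠ 0 := by positivity
  field_simp

lemma relative_error_of_boundedBelow (hD : 0 < D) (hO : 0 < O) (x x' : Fin D → ℝ) {M : ℕ}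
    (hM : 0 < M) (hK : BoundedBelow (L := M + 1) (D := D) (O := O)
      fun n θ => actKer (widths D n O (M + 1)) (extParams θ) M x x' / n)
    (δ : ℝ) (hδ : 0 < δ) :
    ∃ (n₀ : ℕ) (C : ℝ), ∀ n : ℕ, n₀ < n →
      ENNReal.ofReal (1 - δ) ≤
        initMeasure (M + 1) (widths D n O (M + 1))
          {θ : Params (M + 1) (widths D n O (M + 1)) |
            frobNorm (eNTK (M + 1) (widths D n O (M + 1)) θ x x' -
                pNTK (M + 1) (widths D n O (M + 1)) θ x x' •
                  (1 : Matrix (Fin (widths D n O (M + 1) (M + 1)))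
                    (Fin (widths D n O (M + 1) (M + 1))) ℝ)) /
              frobNorm (eNTK (M + 1) (widths D n O (M + 1)) θ x x') ≤ C / Real.sqrt n} := by
  obtain ⟨c, hc, n₁, h1⟩ := hK (δ / 3) (by positivity)
  obtain ⟨B, hB, h2⟩ := exists_meanLE_sum_kerFluct_sq (O := O) hD x x' hM
  obtain ⟨B', hB', h3⟩ := exists_meanLE_negTrace O hD x x' M (by lia : M < M + 1)
  have hmarkov {b : ℝ} (hb : 0 ≤ b) : b / √(3 * (b + 1) / δ) ^ 2 ≤ δ / 3 := by
    rw [Real.sq_sqrt (by positivity)]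
    rw [div_le_iff₀ (by positivity)]
    field_simp
    linarith
  have hs : 0 < √(3 * (B + 1) / δ) := Real.sqrt_pos.2 (by positivity)
  have hs' : 0 < √(3 * (B' + 1) / δ) := Real.sqrt_pos.2 (by positivity)
  have hmB := hmarkov hB
  have hmB' := hmarkov hB'
  set s := √(3 * (B + 1) / δ)
  set s' := √(3 * (B' + 1) / δ)
  refine ⟨n₁ + ⌈(2 * (s + s') / c) ^ 2⌉₊, √(2 + 2 * (O : ℝ)) * s / (c / 2), fun n hn => ?_⟩
  have hn0 : 0 < n := by lia
  have hnR : (0 : ℝ) < n := by exact_mod_cast hn0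
  have hr : 0 < √(n : ℝ) := Real.sqrt_pos.2 hnR
  have hrn : √(n : ℝ) * √(n : ℝ) = n := Real.mul_self_sqrt hnR.le
  have hrs : 2 * (s + s') / c ≤ √(n : ℝ) := Real.le_sqrt_of_sq_le
    ((Nat.le_ceil _).trans (by exact_mod_cast (by lia : ⌈(2 * (s + s') / c) ^ 2⌉₊ ≤ n)))
  have hgap : (s + s') * √(n : ℝ) ≤ c / 2 * n := by
    rw [div_le_iff₀ hc] at hrs
    nlinarith [mul_le_mul_of_nonneg_right hrs hr.le]
  have hb1 := h1 n (by lia)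
  have hb2 := (h2 n hn0).measure_le (t := (s * √(n : ℝ)) ^ 2) (by positivity)
  have hb3 := (h3 n hn0).measure_le (t := (s' * √(n : ℝ) * n) ^ 2) (by positivity)
  have e2 : B * n / (s * √(n : ℝ)) ^ 2 = B / s ^ 2 := by
    rw [mul_pow, Real.sq_sqrt hnR.le]
    field_simp
  have e3 : B' * (n : ℝ) ^ 3 / (s' * √(n : ℝ) * n) ^ 2 = B' / s' ^ 2 := by
    rw [mul_pow, mul_pow, Real.sq_sqrt hnR.le]
    field_simp
  rw [e2] at hb2
  rw [e3] at hb3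
  have hwz : ∀ l < M + 1, widths D n O (M + 1) l ≠ 0 := fun l hl => widths_ne_zero hD hn0 hl
  have hnd := ae_nondegenerate (L := M + 1) hwz x
  have hnd' := ae_nondegenerate (L := M + 1) hwz x'
  rw [ae_iff] at hnd hnd'
  refine ofReal_one_sub_le_measure hδ.le
    (t := ((({θ | actKer (widths D n O (M + 1)) (extParams θ) M x x' / n < c} ∪
      {θ | (s * √(n : ℝ)) ^ 2 ≤
        ∑ a, ∑ b, kerFluct (widths D n O (M + 1)) (extParams θ) x x' M a b ^ 2}) ∪
      {θ | (s' * √(n : ℝ) * n) ^ 2 ≤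
        max 0 (-postTrace (widths D n O (M + 1)) (extParams θ) x x' M) ^ 2}) ∪
      {θ | ¬ Nondegenerate θ x}) ∪ {θ | ¬ Nondegenerate θ x'}) (fun θ hθ => ?_) ?_
  · simp only [Set.mem_union, Set.mem_ofPred_eq, not_or, not_not, not_lt, not_le] at hθ
    obtain ⟨⟨⟨⟨g1, g2⟩, g3⟩, g4⟩, g5⟩ := hθ
    have hwO : (widths D n O (M + 1) (M + 1) : ℝ) = O := by rw [widths_last (by lia)]
    have hwM : (widths D n O (M + 1) M : ℝ) = n := by rw [widths_hidden hM (by lia)]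
    have hQ : max 0 (-postTrace (widths D n O (M + 1)) (extParams θ) x x' M) <
        s' * √(n : ℝ) * n := lt_of_pow_lt_pow_left₀ 2 (by positivity) g3
    have hT : -(s' * √(n : ℝ) * n) ≤
        postTrace (widths D n O (M + 1)) (extParams θ) x x' M := by
      have := (le_max_right _ _).trans hQ.le
      linarith
    have hvT : -(s' * √(n : ℝ)) ≤ (widths D n O (M + 1) M : ℝ)⁻¹ *
        postTrace (widths D n O (M + 1)) (extParams θ) x x' M := by
      rw [hwM, inv_mul_eq_div, le_div_iff₀ hnR]
      linarith
    rw [le_div_iff₀ hnR] at g1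
    have key := g4.frobNorm_ratio_le g5 (by rw [widths_last (by lia)]; lia)
      (F := s * √(n : ℝ)) (d := c / 2 * n) (by positivity) g2.le (by positivity) (by linarith)
    refine key.trans (le_of_eq ?_)
    rw [hwO]
    nth_rewrite 2 [← hrn]
    field_simp
  · have hsum : ENNReal.ofReal δ =
        ENNReal.ofReal (δ / 3) + ENNReal.ofReal (δ / 3) + ENNReal.ofReal (δ / 3) + 0 + 0 := by
      rw [← ENNReal.ofReal_add (by positivity) (by positivity),
        ← ENNReal.ofReal_add (by positivity) (by positivity), add_zero, add_zero]
      congr 1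
      ring
    rw [hsum]
    refine (measure_union_le _ _).trans (add_le_add ?_ hnd'.le)
    refine (measure_union_le _ _).trans (add_le_add ?_ hnd.le)
    refine (measure_union_le _ _).trans (add_le_add ?_
      (hb3.trans (ENNReal.ofReal_le_ofReal hmB')))
    exact (measure_union_le _ _).trans (add_le_add hb1
      (hb2.trans (ENNReal.ofReal_le_ofReal hmB)))

lemma relative_error_of_preKer_eq_zero {L : ℕ} (hD : 0 < D) (x x' : Fin D → ℝ)
    (hz : ∀ n, ∀ θ : Params L (widths D n O L),
      preKer (widths D n O L) (extParams θ) x x' L = 0) (δ : ℝ) (hδ : 0 < δ) :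
    ∃ (n₀ : ℕ) (C : ℝ), ∀ n : ℕ, n₀ < n →
      ENNReal.ofReal (1 - δ) ≤
        initMeasure L (widths D n O L)
          {θ : Params L (widths D n O L) |
            frobNorm (eNTK L (widths D n O L) θ x x' -
                pNTK L (widths D n O L) θ x x' •
                  (1 : Matrix (Fin (widths D n O L L)) (Fin (widths D n O L L)) ℝ)) /
              frobNorm (eNTK L (widths D n O L) θ x x') ≤ C / Real.sqrt n} := by
  refine ⟨0, 0, fun n hn => ?_⟩
  have hwz : ∀ l < L, widths D n O L l ≠ 0 := fun l hl => widths_ne_zero hD hn hl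
  have hnd := ae_nondegenerate (L := L) hwz x
  have hnd' := ae_nondegenerate (L := L) hwz x'
  rw [ae_iff] at hnd hnd'
  refine ofReal_one_sub_le_measure hδ.le
    (t := {θ | ¬ Nondegenerate θ x} ∪ {θ | ¬ Nondegenerate θ x'}) (fun θ hθ => ?_) ?_
  · simp only [Set.mem_union, Set.mem_ofPred_eq, not_or, not_not] at hθ
    rw [zero_div]
    exact (hθ.1.frobNorm_ratio_eq_zero hθ.2 (hz n θ) _).le
  · refine (measure_union_le _ _).trans ?_
    rw [hnd, hnd', add_zero]
    exact zero_le

end RelativeError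

/-- **Theorem 1 (pNTK converges to eNTK in relative Frobenius norm).**
For a fully-connected ReLU network of depth `L` with hidden widths `n`, He/fan-in
initialization, and fixed inputs `x₁, x₂` in a compact set, for every `δ > 0` there are
`n₀` and a constant `C` (independent of `n`) such that for all `n > n₀`, with probability
at least `1 - δ` over the random initialization,
`‖Θ_θ(x₁,x₂) - Θ̂_θ(x₁,x₂) • I_O‖_F / ‖Θ_θ(x₁,x₂)‖_F ≤ C n^{-1/2}`. -/
theorem pNTK_eNTK_relative_frobenius_convergence
    (D O L : ℕ) (hD : 0 < D) (hO : 0 < O) (hL : 2 ≤ L)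
    (S : Set (Fin D → ℝ)) (hS : IsCompact S)
    (x₁ x₂ : Fin D → ℝ) (hx₁ : x₁ ∈ S) (hx₂ : x₂ ∈ S)
    (δ : ℝ) (hδ : 0 < δ) :
    ∃ (n₀ : ℕ) (C : ℝ), ∀ n : ℕ, n₀ < n →
      ENNReal.ofReal (1 - δ) ≤
        initMeasure L (widths D n O L)
          {θ : Params L (widths D n O L) |
            frobNorm (eNTK L (widths D n O L) θ x₁ x₂ -
                pNTK L (widths D n O L) θ x₁ x₂ •
                  (1 : Matrix (Fin (widths D n O L L)) (Fin (widths D n O L L)) ℝ)) /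
              frobNorm (eNTK L (widths D n O L) θ x₁ x₂) ≤ C / Real.sqrt n} := by
  obtain ⟨M, rfl⟩ : ∃ M, L = M + 1 := Nat.exists_eq_succ_of_ne_zero (by lia)
  have hM : 0 < M := by lia
  rcases common_direction_or x₁ x₂ with h0 | hdir | ⟨c, hc, hopp⟩
  · exact relative_error_of_preKer_eq_zero hD x₁ x₂ (fun n θ => preKer_of_eq_zero h0 _) δ hδ
  · exact relative_error_of_boundedBelow hD hO x₁ x₂ hM
      ((boundedBelow_actKer_one hD (by lia) hdir).actKer_of_le hD one_pos (by lia) (by lia)) δ hδ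
  · subst hopp
    by_cases hx : x₁ = 0
    · exact relative_error_of_preKer_eq_zero hD x₁ _
        (fun n θ => preKer_of_eq_zero (Or.inl hx) _) δ hδ
    obtain rfl | hM2 : 1 = M ∨ 2 ≤ M := eq_or_lt_of_le hM
    · refine relative_error_of_preKer_eq_zero hD x₁ _ (fun n θ => ?_) δ hδ
      exact preKer_two_opposite hc
    · exact relative_error_of_boundedBelow hD hO x₁ _ hM
        ((boundedBelow_actKer_two hD (by lia) hx hc).actKer_of_le hD two_pos hM2 (by lia)) δ hδ

end
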